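/- arXiv:1707.01155 — 5 statements merged into one kernel-verified Lean document; each statement's English description precedes it below -/
import Mathlib

section
/- Consider the S2GD algorithm under the stated assumptions. Suppose 0 ≤ ν ≤ μ, 0 < h < 1/(2L), and m ≥ 1 is large enough that c := (1 − νh)^m / (β μ h (1 − 2Lh)) + 2(L − μ)h / (1 − 2Lh) < 1, where β := Σ_{t=1}^m (1 − νh)^{m−t}. Then for every k ≥ 0 the iterates satisfy E[P(w^k) − P(w*)] ≤ c^k · (P(w^0) − P(w*)). -/
open scoped RealInnerProductSpace BigOperators

noncomputable section

/-- One stochastic inner step of the S2GD algorithm: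
`y ↦ y − h (g + ∇f_i(y) − ∇f_i(w))`, where `g = ∇P(w)`. -/
def s2gdInnerStep {d n : ℕ}
    (f' : Fin n → EuclideanSpace ℝ (Fin d) → EuclideanSpace ℝ (Fin d)) (h : ℝ)
    (w g : EuclideanSpace ℝ (Fin d)) (i : Fin n) (y : EuclideanSpace ℝ (Fin d)) :
    EuclideanSpace ℝ (Fin d) :=
  y - h • (g + f' i y - f' i w)

/-- The result `y^{T}` of one S2GD epoch of length `T` (with `T ≤ m`) started at `w`,
where the `t`-th inner step (`t = 0, …, T−1`) uses the sampled index `σ t`. -/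
def s2gdEpoch {d n : ℕ}
    (f' : Fin n → EuclideanSpace ℝ (Fin d) → EuclideanSpace ℝ (Fin d))
    (P' : EuclideanSpace ℝ (Fin d) → EuclideanSpace ℝ (Fin d)) (h : ℝ) (m : ℕ)
    (w : EuclideanSpace ℝ (Fin d)) (T : ℕ) (σ : Fin m → Fin n) :
    EuclideanSpace ℝ (Fin d) :=
  (List.finRange m).foldl
    (fun y (t : Fin m) => if (t : ℕ) < T then s2gdInnerStep f' h w (P' w) (σ t) y else y) w

/-- The iterate `w^k` produced by `k` epochs of S2GD started from `w0`, given the random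
seed `ω`: in epoch `j`, the epoch length is `t^j = (ω j).1 + 1 ∈ {1, …, m}` and the indices
sampled in the inner loop are given by `(ω j).2`. -/
def s2gdIterate {d n : ℕ}
    (f' : Fin n → EuclideanSpace ℝ (Fin d) → EuclideanSpace ℝ (Fin d))
    (P' : EuclideanSpace ℝ (Fin d) → EuclideanSpace ℝ (Fin d)) (h : ℝ) (m : ℕ)
    (w0 : EuclideanSpace ℝ (Fin d)) (k : ℕ) (ω : Fin k → Fin m × (Fin m → Fin n)) :
    EuclideanSpace ℝ (Fin d) :=
  (List.finRange k).foldl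
    (fun w j => s2gdEpoch f' P' h m w (((ω j).1 : ℕ) + 1) (ω j).2) w0

/-- The probability of the random seed `ω` of `k` epochs of S2GD: each epoch length
`t = T+1` has probability `(1 − νh)^{m−t} / β` and each of the `m` uniform index draws of an
epoch has probability `1/n`. -/
def s2gdWeight (n : ℕ) (ν h β : ℝ) (m : ℕ) {k : ℕ}
    (ω : Fin k → Fin m × (Fin m → Fin n)) : ℝ :=
  ∏ j, ((1 - ν * h) ^ (m - (((ω j).1 : ℕ) + 1)) / β) * ((1 : ℝ) / (n : ℝ)) ^ m

section Helpers

variable {E : Type*} [NormedAddCommGroup E] [InnerProductSpace ℝ E] [CompleteSpace E]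

lemma s2gd_line_deriv {f : E → ℝ} {f' : E → E} (hg : ∀ x, HasGradientAt f (f' x) x)
    (x v : E) (t : ℝ) :
    HasDerivAt (fun s : ℝ => f (x + s • v)) ⟪f' (x + t • v), v⟫ t := by
  have h1 : HasDerivAt (fun s : ℝ => x + s • v) v t := by
    simpa using ((hasDerivAt_id t).smul_const v).const_add x
  have h2 := (hg (x + t • v)).hasFDerivAt.comp_hasDerivAt t h1
  simpa [Function.comp_def] using h2

lemma s2gd_descent {f : E → ℝ} {f' : E → E} (hg : ∀ x, HasGradientAt f (f' x) x)
    {L : ℝ} (hLip : ∀ x y, ‖f' x - f' y‖ ≤ L * ‖x - y‖) (x z : E) :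
    f z ≤ f x + ⟪f' x, z - x⟫ + L / 2 * ‖z - x‖ ^ 2 := by
  set v := z - x with hv
  have hd : ∀ t : ℝ, HasDerivAt
      (fun s : ℝ => f (x + s • v) - s * ⟪f' x, v⟫ - L / 2 * ‖v‖ ^ 2 * s ^ 2)
      (⟪f' (x + t • v), v⟫ - ⟪f' x, v⟫ - L * ‖v‖ ^ 2 * t) t := by
    intro t
    have h1 := s2gd_line_deriv hg x v t
    have h2 := (hasDerivAt_id t).mul_const ⟪f' x, v⟫
    have h3 := (hasDerivAt_pow 2 t).const_mul (L / 2 * ‖v‖ ^ 2)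
    refine ((h1.sub h2).sub h3).congr_deriv ?_
    norm_num
    ring
  have hanti : AntitoneOn
      (fun s : ℝ => f (x + s • v) - s * ⟪f' x, v⟫ - L / 2 * ‖v‖ ^ 2 * s ^ 2)
      (Set.Icc 0 1) := by
    apply antitoneOn_of_deriv_nonpos (convex_Icc 0 1)
    · exact fun t _ => (hd t).continuousAt.continuousWithinAt
    · exact fun t _ => (hd t).differentiableAt.differentiableWithinAt
    · intro t ht
      rw [interior_Icc] at ht
      rw [(hd t).deriv, ← inner_sub_left]
      have h1 := real_inner_le_norm (f' (x + t • v) - f' x) v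
      have h2 := hLip (x + t • v) x
      rw [add_sub_cancel_left, norm_smul, Real.norm_of_nonneg ht.1.le] at h2
      have h3 := mul_le_mul_of_nonneg_right h2 (norm_nonneg v)
      nlinarith
  have := hanti (Set.left_mem_Icc.2 zero_le_one) (Set.right_mem_Icc.2 zero_le_one) zero_le_one
  simp [hv] at this
  linarith

lemma s2gd_convex {f : E → ℝ} {f' : E → E} (hg : ∀ x, HasGradientAt f (f' x) x)
    (hc : ConvexOn ℝ Set.univ f) (x z : E) : f x + ⟪f' x, z - x⟫ ≤ f z := by
  have hc' : ConvexOn ℝ Set.univ (fun s : ℝ => f (x + s • (z - x))) := by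
    have := hc.comp_affineMap (AffineMap.lineMap x z : ℝ →ᵃ[ℝ] E)
    simpa [Function.comp_def, AffineMap.lineMap_apply, add_comm] using this
  have hd := s2gd_line_deriv hg x (z - x) 0
  have := hc'.le_slope_of_hasDerivAt (Set.mem_univ 0) (Set.mem_univ 1) one_pos hd
  simp [slope_def_field] at this
  linarith

lemma s2gd_cocoercive {f : E → ℝ} {f' : E → E} (hg : ∀ x, HasGradientAt f (f' x) x)
    (hc : ConvexOn ℝ Set.univ f) {L : ℝ} (hL : 0 < L)
    (hLip : ∀ x y, ‖f' x - f' y‖ ≤ L * ‖x - y‖) (x y : E) :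
    ‖f' x - f' y‖ ^ 2 ≤ 2 * L * (f x - f y - ⟪f' y, x - y⟫) := by
  set g := f' x - f' y with hgd
  have h1 := s2gd_convex hg hc y (x - (1 / L) • g)
  have h2 := s2gd_descent hg hLip x (x - (1 / L) • g)
  have e1 : x - (1 / L) • g - y = (x - y) - (1 / L) • g := by abel
  have e2 : x - (1 / L) • g - x = - ((1 / L) • g) := by abel
  rw [e1, inner_sub_right, inner_smul_right] at h1
  rw [e2, inner_neg_right, inner_smul_right, norm_neg, norm_smul, mul_pow,
    Real.norm_of_nonneg (by positivity)] at h2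
  have e3 : ⟪f' x, g⟫ - ⟪f' y, g⟫ = ‖g‖ ^ 2 := by
    rw [← inner_sub_left, ← hgd, real_inner_self_eq_norm_sq]
  have e4 : L / 2 * ((1 / L) ^ 2 * ‖g‖ ^ 2) = 1 / L * ‖g‖ ^ 2 / 2 := by field_simp
  have e5 : 1 / L * ⟪f' x, g⟫ - 1 / L * ⟪f' y, g⟫ = 1 / L * ‖g‖ ^ 2 := by
    rw [← e3]; ring
  have h3 : 1 / L * ‖g‖ ^ 2 / 2 ≤ f x - f y - ⟪f' y, x - y⟫ := by linarith
  calc ‖g‖ ^ 2 = 2 * L * (1 / L * ‖g‖ ^ 2 / 2) := by field_simp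
    _ ≤ _ := by gcongr

/-- one-step bound before averaging -/
lemma s2gd_step_pre (y w s g a b c : E) (h A B : ℝ)
    (hA : ‖a - c‖ ^ 2 ≤ A) (hB : ‖b - c‖ ^ 2 ≤ B) :
    ‖y - h • (g + a - b) - s‖ ^ 2 ≤ ‖y - s‖ ^ 2
      - 2 * h * (⟪g, y - s⟫ + ⟪a, y - s⟫ - ⟪b, y - s⟫)
      + h ^ 2 * (2 * A + 2 * B - 4 * (⟪b, g⟫ - ⟪c, g⟫) + 2 * ‖g‖ ^ 2) := by
  have e1 : y - h • (g + a - b) - s = (y - s) - h • (g + a - b) := by abel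
  have e2 : ‖(y - s) - h • (g + a - b)‖ ^ 2 = ‖y - s‖ ^ 2
      - 2 * h * (⟪g, y - s⟫ + ⟪a, y - s⟫ - ⟪b, y - s⟫) + h ^ 2 * ‖g + a - b‖ ^ 2 := by
    rw [norm_sub_sq_real, inner_smul_right, norm_smul, mul_pow, Real.norm_eq_abs, sq_abs,
      real_inner_comm, inner_sub_left, inner_add_left]
    ring
  have e3 : ‖g + a - b‖ ^ 2 ≤ 2 * ‖a - c‖ ^ 2 + 2 * ‖b - c - g‖ ^ 2 := by
    have e : g + a - b = (a - c) - (b - c - g) := by abel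
    have := parallelogram_law_with_norm ℝ (a - c) (b - c - g)
    rw [e]
    nlinarith [sq_nonneg ‖a - c + (b - c - g)‖]
  have e4 : ‖b - c - g‖ ^ 2 = ‖b - c‖ ^ 2 - 2 * (⟪b, g⟫ - ⟪c, g⟫) + ‖g‖ ^ 2 := by
    rw [norm_sub_sq_real, inner_sub_left]
  rw [e1, e2]
  have : h ^ 2 * ‖g + a - b‖ ^ 2 ≤
      h ^ 2 * (2 * A + 2 * B - 4 * (⟪b, g⟫ - ⟪c, g⟫) + 2 * ‖g‖ ^ 2) := by
    apply mul_le_mul_of_nonneg_left _ (sq_nonneg h)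
    linarith
  linarith

lemma s2gd_avg_descent {n : ℕ} (hn : 0 < n) {f : Fin n → E → ℝ} {f' : Fin n → E → E}
    (hgrad : ∀ i x, HasGradientAt (f i) (f' i x) x)
    {L : ℝ} (hLip : ∀ i (x y : E), ‖f' i x - f' i y‖ ≤ L * ‖x - y‖)
    {P : E → ℝ} (hP : ∀ w, P w = (1 / (n : ℝ)) * ∑ i, f i w)
    {P' : E → E} (hP' : ∀ w, P' w = (1 / (n : ℝ)) • ∑ i, f' i w) (x z : E) :
    P z ≤ P x + ⟪P' x, z - x⟫ + L / 2 * ‖z - x‖ ^ 2 := by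
  have hn' : (0 : ℝ) < n := by exact_mod_cast hn
  have h1 : ∑ i, f i z ≤ ∑ i, (f i x + ⟪f' i x, z - x⟫ + L / 2 * ‖z - x‖ ^ 2) :=
    Finset.sum_le_sum fun i _ => s2gd_descent (hgrad i) (hLip i) x z
  simp only [Finset.sum_add_distrib, Finset.sum_const, Finset.card_univ, Fintype.card_fin,
    nsmul_eq_mul, ← sum_inner] at h1
  have h2 := mul_le_mul_of_nonneg_left h1 (by positivity : (0 : ℝ) ≤ 1 / n)
  rw [hP, hP, hP', real_inner_smul_left]
  refine h2.trans (le_of_eq ?_)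
  field_simp

lemma s2gd_step {n : ℕ} (hn : 0 < n) {f : Fin n → E → ℝ} {f' : Fin n → E → E}
    (hgrad : ∀ i x, HasGradientAt (f i) (f' i x) x)
    (hconvex : ∀ i, ConvexOn ℝ Set.univ (f i))
    {L : ℝ} (hL : 0 < L) (hLip : ∀ i (x y : E), ‖f' i x - f' i y‖ ≤ L * ‖x - y‖)
    {P : E → ℝ} (hP : ∀ w, P w = (1 / (n : ℝ)) * ∑ i, f i w)
    {P' : E → E} (hP' : ∀ w, P' w = (1 / (n : ℝ)) • ∑ i, f' i w)
    {μ : ℝ} (hμ : 0 < μ)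
    (hstrong : ∀ x z : E, P x + ⟪P' x, z - x⟫ + μ / 2 * ‖z - x‖ ^ 2 ≤ P z)
    {s : E} (hs : P' s = 0) {h ν : ℝ} (hνμ : ν ≤ μ) (hh0 : 0 < h) (w y : E) :
    (1 / (n : ℝ)) * ∑ i, ‖y - h • (P' w + f' i y - f' i w) - s‖ ^ 2
      ≤ (1 - ν * h) * ‖y - s‖ ^ 2 + (-(2 * h * (1 - 2 * L * h))) * (P y - P s)
        + 4 * (L - μ) * h ^ 2 * (P w - P s) := by
  have hn' : (0 : ℝ) < n := by exact_mod_cast hn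
  have h1 := Finset.sum_le_sum fun i (_ : i ∈ Finset.univ) =>
    s2gd_step_pre y w s (P' w) (f' i y) (f' i w) (f' i s) h _ _
      (s2gd_cocoercive (hgrad i) (hconvex i) hL (hLip i) y s)
      (s2gd_cocoercive (hgrad i) (hconvex i) hL (hLip i) w s)
  have h2 := mul_le_mul_of_nonneg_left h1 (by positivity : (0 : ℝ) ≤ 1 / n)
  have hin : ∀ x u : E, ∑ i, ⟪f' i x, u⟫ = n * ⟪P' x, u⟫ := by
    intro x u
    rw [hP', real_inner_smul_left, sum_inner]; field_simp
  have hf : ∀ x : E, ∑ i, f i x = n * P x := by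
    intro x
    rw [hP]; field_simp
  simp only [Finset.sum_add_distrib, Finset.sum_sub_distrib, Finset.sum_const, Finset.card_univ,
    Fintype.card_fin, nsmul_eq_mul, ← Finset.mul_sum, hin, hf, hs, inner_zero_left,
    real_inner_self_eq_norm_sq] at h2
  refine h2.trans ?_
  have hg : 2 * μ * (P w - P s) ≤ ‖P' w‖ ^ 2 := by
    have a1 := hstrong w s
    have a2 : 0 ≤ ‖P' w + μ • (s - w)‖ ^ 2 := by positivity
    rw [norm_add_sq_real, inner_smul_right, norm_smul, mul_pow, Real.norm_eq_abs, sq_abs] at a2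
    nlinarith
  have hy : P y - P s + ν / 2 * ‖y - s‖ ^ 2 ≤ ⟪P' y, y - s⟫ := by
    have a1 := hstrong y s
    have e : s - y = - (y - s) := by abel
    rw [e, inner_neg_right, norm_neg] at a1
    have := mul_le_mul_of_nonneg_right hνμ (sq_nonneg ‖y - s‖)
    linarith
  have key : ‖y - s‖ ^ 2 - 2 * h * ⟪P' y, y - s⟫
      + h ^ 2 * (4 * L * (P y - P s) + 4 * L * (P w - P s) - 2 * ‖P' w‖ ^ 2)
      ≤ (1 - ν * h) * ‖y - s‖ ^ 2 + (-(2 * h * (1 - 2 * L * h))) * (P y - P s)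
        + 4 * (L - μ) * h ^ 2 * (P w - P s) := by
    have b1 := mul_le_mul_of_nonneg_left hy hh0.le
    have b2 := mul_le_mul_of_nonneg_left hg (sq_nonneg h)
    linarith
  refine le_trans (le_of_eq ?_) key
  field_simp
  ring

lemma s2gd_grad_zero {L : ℝ} (hL : 0 < L) {P : E → ℝ} {P' : E → E}
    (hd : ∀ x z, P z ≤ P x + ⟪P' x, z - x⟫ + L / 2 * ‖z - x‖ ^ 2)
    {s : E} (hmin : ∀ w, P s ≤ P w) : P' s = 0 := by
  have h1 := hd s (s - (1 / L) • P' s)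
  have h2 := hmin (s - (1 / L) • P' s)
  have e2 : s - (1 / L) • P' s - s = - ((1 / L) • P' s) := by abel
  rw [e2, inner_neg_right, inner_smul_right, norm_neg, norm_smul, mul_pow,
    Real.norm_of_nonneg (by positivity), real_inner_self_eq_norm_sq] at h1
  have e4 : L / 2 * ((1 / L) ^ 2 * ‖P' s‖ ^ 2) = 1 / L * ‖P' s‖ ^ 2 / 2 := by field_simp
  have h3 : 1 / L * ‖P' s‖ ^ 2 ≤ 0 := by linarith
  have h4 : ‖P' s‖ ^ 2 ≤ 0 := by
    have : ‖P' s‖ ^ 2 = L * (1 / L * ‖P' s‖ ^ 2) := by field_simp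
    rw [this]; exact mul_nonpos_of_nonneg_of_nonpos hL.le h3
  have : ‖P' s‖ = 0 := by
    have := sq_nonneg ‖P' s‖
    exact pow_eq_zero_iff (two_ne_zero) |>.1 (le_antisymm h4 this)
  simpa using this

end Helpers

section Averaging

/-- averaging operator of one uniformly sampled step -/
def s2gdAvg {E : Type*} {n : ℕ} (step : Fin n → E → E) (φ : E → ℝ) (y : E) : ℝ :=
  (1 / (n : ℝ)) * ∑ i, φ (step i y)

lemma s2gdAvg_iterate_le {E : Type*} {n : ℕ} (hn : 0 < n) (step : Fin n → E → E)
    (φ ψ χ : E → ℝ) (a b c : ℝ) (hle : ∀ y, φ y ≤ a * ψ y + b * χ y + c) (t : ℕ) :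
    ∀ y, (s2gdAvg step)^[t] φ y
      ≤ a * (s2gdAvg step)^[t] ψ y + b * (s2gdAvg step)^[t] χ y + c := by
  have hn' : (0 : ℝ) < n := by exact_mod_cast hn
  induction t with
  | zero => simpa using hle
  | succ t ih =>
    intro y
    simp only [Function.iterate_succ_apply']
    have h1 := Finset.sum_le_sum fun i (_ : i ∈ Finset.univ) => ih (step i y)
    have h2 := mul_le_mul_of_nonneg_left h1 (by positivity : (0 : ℝ) ≤ 1 / n)
    refine h2.trans (le_of_eq ?_)
    simp only [Finset.sum_add_distrib, Finset.sum_const, Finset.card_univ,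
      Fintype.card_fin, nsmul_eq_mul, ← Finset.mul_sum, s2gdAvg]
    field_simp

lemma s2gd_sum_cons {α : Type*} [Fintype α] (m : ℕ) (F : (Fin (m + 1) → α) → ℝ) :
    ∑ σ, F σ = ∑ a : α, ∑ τ : Fin m → α, F (Fin.cons a τ) := by
  rw [← Fintype.sum_prod_type', ← (Fin.consEquiv (fun _ : Fin (m + 1) => α)).sum_comp]
  rfl

lemma s2gd_epoch_expect {E : Type*} {n : ℕ} (hn : 0 < n) (step : Fin n → E → E)
    (φ : E → ℝ) (m : ℕ) : ∀ (T : ℕ), T ≤ m → ∀ y : E,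
    ∑ σ : Fin m → Fin n, (1 / (n : ℝ)) ^ m * φ ((List.finRange m).foldl
      (fun y (t : Fin m) => if (t : ℕ) < T then step (σ t) y else y) y)
      = (s2gdAvg step)^[T] φ y := by
  have hn' : (0 : ℝ) < n := by exact_mod_cast hn
  induction m with
  | zero =>
    intro T hT y
    obtain rfl : T = 0 := by omega
    simp
  | succ m ih =>
    intro T hT y
    rw [s2gd_sum_cons]
    rcases T with _ | T
    · have := ih 0 (Nat.zero_le _) y
      simp only [not_lt_zero, if_false, Function.iterate_zero, id,
        List.foldl_fixed, Finset.sum_const, nsmul_eq_mul] at this ⊢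
      rw [pow_succ]
      simp only [Finset.card_univ, Fintype.card_fin] at this ⊢
      field_simp at this ⊢
      exact this
    · rw [Function.iterate_succ_apply', s2gdAvg, Finset.mul_sum]
      refine Finset.sum_congr rfl fun i _ => ?_
      rw [← ih T (by omega) (step i y), Finset.mul_sum]
      refine Finset.sum_congr rfl fun τ _ => ?_
      rw [List.finRange_succ, List.foldl_cons, List.foldl_map]
      simp only [Fin.val_zero, Nat.zero_lt_succ, if_true, Fin.cons_zero, Fin.cons_succ,
        Fin.val_succ, Nat.add_lt_add_iff_right]
      rw [pow_succ]; ring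

/-- recursion for the weighted sums -/
lemma s2gd_wsum_succ (q : ℝ) (D : ℕ → ℝ) (m : ℕ) :
    ∑ t ∈ Finset.range (m + 1), q ^ (m + 1 - (t + 1)) * D t
      = q * (∑ t ∈ Finset.range m, q ^ (m - (t + 1)) * D t) + D m := by
  rw [Finset.sum_range_succ, Finset.mul_sum]
  congr 1
  · refine Finset.sum_congr rfl fun t ht => ?_
    have : m + 1 - (t + 1) = (m - (t + 1)) + 1 := by
      have := Finset.mem_range.1 ht; omega
    rw [this, pow_succ]; ring
  · simp

lemma s2gd_wsum_shift (q : ℝ) (D : ℕ → ℝ) (m : ℕ) :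
    (∑ t ∈ Finset.range m, q ^ (m - (t + 1)) * D (t + 1)) + q ^ m * D 0
      = q * (∑ t ∈ Finset.range m, q ^ (m - (t + 1)) * D t) + D m := by
  induction m with
  | zero => simp
  | succ m ih =>
    rw [s2gd_wsum_succ q D, s2gd_wsum_succ q (fun t => D (t + 1)), ← ih]
    ring

lemma s2gd_wsum_bound (q a b : ℝ) (hq : 0 ≤ q) (R D : ℕ → ℝ)
    (hR : ∀ t, R (t + 1) ≤ q * R t + (-a) * D t + b) (m : ℕ) :
    R m + a * (∑ t ∈ Finset.range m, q ^ (m - (t + 1)) * D t)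
      ≤ q ^ m * R 0 + b * ∑ t ∈ Finset.range m, q ^ (m - (t + 1)) := by
  induction m with
  | zero => simp
  | succ m ih =>
    have h1 := s2gd_wsum_succ q (fun _ => 1) m
    simp only [mul_one] at h1
    rw [s2gd_wsum_succ, h1, pow_succ]
    have h2 := mul_le_mul_of_nonneg_left ih hq
    have h3 := hR m
    linarith

end Averaging

section Epoch

lemma s2gd_epoch_bound
    {d n : ℕ} (hn : 0 < n)
    {f : Fin n → EuclideanSpace ℝ (Fin d) → ℝ}
    {f' : Fin n → EuclideanSpace ℝ (Fin d) → EuclideanSpace ℝ (Fin d)}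
    (hgrad : ∀ i x, HasGradientAt (f i) (f' i x) x)
    (hconvex : ∀ i, ConvexOn ℝ Set.univ (f i))
    {L : ℝ} (hL : 0 < L)
    (hLip : ∀ i (x y : EuclideanSpace ℝ (Fin d)), ‖f' i x - f' i y‖ ≤ L * ‖x - y‖)
    {P : EuclideanSpace ℝ (Fin d) → ℝ}
    (hP : ∀ w, P w = (1 / (n : ℝ)) * ∑ i, f i w)
    {P' : EuclideanSpace ℝ (Fin d) → EuclideanSpace ℝ (Fin d)}
    (hP' : ∀ w, P' w = (1 / (n : ℝ)) • ∑ i, f' i w)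
    {μ : ℝ} (hμ : 0 < μ)
    (hstrong : ∀ x z : EuclideanSpace ℝ (Fin d),
      P x + ⟪P' x, z - x⟫ + μ / 2 * ‖z - x‖ ^ 2 ≤ P z)
    {wstar : EuclideanSpace ℝ (Fin d)} (hmin : ∀ w, P wstar ≤ P w)
    {m : ℕ} {h ν : ℝ}
    (hν0 : 0 ≤ ν) (hνμ : ν ≤ μ) (hνh : ν * h < 1)
    (hh0 : 0 < h) (h2L : 0 < 1 - 2 * L * h)
    {β : ℝ} (hβ : β = ∑ t ∈ Finset.range m, (1 - ν * h) ^ (m - (t + 1))) (hβ0 : 0 < β)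
    {c : ℝ}
    (hc : c = (1 - ν * h) ^ m / (β * μ * h * (1 - 2 * L * h))
        + 2 * (L - μ) * h / (1 - 2 * L * h))
    (w : EuclideanSpace ℝ (Fin d)) :
    ∑ x : Fin m × (Fin m → Fin n),
        ((1 - ν * h) ^ (m - ((x.1 : ℕ) + 1)) / β) * ((1 : ℝ) / (n : ℝ)) ^ m
          * (P (s2gdEpoch f' P' h m w ((x.1 : ℕ) + 1) x.2) - P wstar)
      ≤ c * (P w - P wstar) := by
  have hdesc := s2gd_avg_descent hn hgrad hLip hP hP'
  have hs : P' wstar = 0 := s2gd_grad_zero hL hdesc hmin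
  set q := 1 - ν * h with hq
  have hq0 : 0 ≤ q := by linarith
  have hq1 : q ≤ 1 := by have := mul_nonneg hν0 hh0.le; linarith
  set step : Fin n → EuclideanSpace ℝ (Fin d) → EuclideanSpace ℝ (Fin d) :=
    fun i y => s2gdInnerStep f' h w (P' w) i y with hstep
  set Δ : EuclideanSpace ℝ (Fin d) → ℝ := fun y => P y - P wstar with hΔ
  set r : EuclideanSpace ℝ (Fin d) → ℝ := fun y => ‖y - wstar‖ ^ 2 with hr
  set D : ℕ → ℝ := fun t => (s2gdAvg step)^[t] Δ w with hD
  set R : ℕ → ℝ := fun t => (s2gdAvg step)^[t] r w with hRd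
  set a := 2 * h * (1 - 2 * L * h) with ha
  have ha0 : 0 < a := by positivity
  set b := 4 * (L - μ) * h ^ 2 * (P w - P wstar) with hb
  -- rewrite the left side
  have hlhs : ∑ x : Fin m × (Fin m → Fin n),
        (q ^ (m - ((x.1 : ℕ) + 1)) / β) * ((1 : ℝ) / (n : ℝ)) ^ m
          * (P (s2gdEpoch f' P' h m w ((x.1 : ℕ) + 1) x.2) - P wstar)
      = (1 / β) * ∑ t ∈ Finset.range m, q ^ (m - (t + 1)) * D (t + 1) := by
    rw [Fintype.sum_prod_type, Finset.sum_range, Finset.mul_sum]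
    refine Finset.sum_congr rfl fun T _ => ?_
    have := s2gd_epoch_expect hn step Δ m (T + 1) T.2 w
    simp only [hD]
    rw [← this, Finset.mul_sum, Finset.mul_sum]
    refine Finset.sum_congr rfl fun σ _ => ?_
    simp only [hΔ, hstep, s2gdEpoch]
    ring
  rw [hlhs]
  have hR : ∀ t, R (t + 1) ≤ q * R t + (-a) * D t + b := by
    intro t
    simp only [hRd, hD]
    rw [Function.iterate_succ_apply]
    refine s2gdAvg_iterate_le hn step _ r Δ q (-a) b (fun y => ?_) t w
    exact s2gd_step hn hgrad hconvex hL hLip hP hP' hμ hstrong hs hνμ hh0 w y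
  have hbound := s2gd_wsum_bound q a b hq0 R D hR m
  rw [← hβ] at hbound
  have hshift := s2gd_wsum_shift q D m
  have hDR : D m ≤ L / 2 * R m := by
    have := s2gdAvg_iterate_le hn step Δ r r (L / 2) 0 0 (fun y => by
      have := hdesc wstar y
      rw [hs, inner_zero_left] at this
      simp only [hΔ, hr]; linarith) m w
    simpa using this
  have hDnn : ∀ t, 0 ≤ D t := by
    intro t
    have := s2gdAvg_iterate_le hn step (fun _ => 0) Δ Δ 1 0 0 (fun y => by
      have := hmin y
      simp only [hΔ]; linarith) t w
    have h0 : (s2gdAvg step)^[t] (fun _ => (0 : ℝ)) = fun _ => 0 := by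
      apply Function.iterate_fixed
      funext y; simp [s2gdAvg]
    rw [h0] at this
    simpa using this
  have hRnn : 0 ≤ R m := by
    have := hDnn m
    by_contra hneg
    push Not at hneg
    nlinarith
  have hR0 : R 0 ≤ 2 / μ * (P w - P wstar) := by
    have := hstrong wstar w
    rw [hs, inner_zero_left] at this
    have e : R 0 = 2 / μ * (μ / 2 * ‖w - wstar‖ ^ 2) := by
      simp only [hRd, hr, Function.iterate_zero, id]; field_simp
    rw [e]
    gcongr
    linarith
  set S := ∑ t ∈ Finset.range m, q ^ (m - (t + 1)) * D t with hS
  have hSnn : 0 ≤ S := Finset.sum_nonneg fun t _ => mul_nonneg (pow_nonneg hq0 _) (hDnn t)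
  set S' := ∑ t ∈ Finset.range m, q ^ (m - (t + 1)) * D (t + 1) with hS'
  have h1 : S' ≤ S + D m := by
    have := mul_nonneg (pow_nonneg hq0 m) (hDnn 0)
    have := mul_le_mul_of_nonneg_right hq1 hSnn
    linarith
  -- a * D m ≤ R m
  have h2 : a * D m ≤ R m := by
    have k1 : a * D m ≤ a * (L / 2 * R m) := mul_le_mul_of_nonneg_left hDR ha0.le
    have k2 : a * (L / 2) ≤ 1 := by
      rw [ha]
      have : 0 < L * h := by positivity
      nlinarith [sq_nonneg (L * h)]
    have k3 := mul_le_mul_of_nonneg_right k2 hRnn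
    linarith
  have h3 : a * S' ≤ q ^ m * (2 / μ * (P w - P wstar)) + b * β := by
    have k1 := mul_le_mul_of_nonneg_left h1 ha0.le
    have k2 := mul_le_mul_of_nonneg_left hR0 (pow_nonneg hq0 m)
    linarith
  have h4 : q ^ m * (2 / μ * (P w - P wstar)) + b * β = a * (β * (c * (P w - P wstar))) := by
    rw [hc, hb, ha]
    field_simp
    ring
  rw [h4] at h3
  have h5 := le_of_mul_le_mul_left h3 ha0
  rw [one_div, inv_mul_le_iff₀ hβ0]
  exact h5

end Epoch

/-- **Linear convergence of S2GD in expectation** (Theorem 2.4 of Konečný's thesis).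
Under convexity, `L`-smoothness of each `f i` and `μ`-strong convexity of `P`, with
`0 ≤ ν ≤ μ`, `0 < h < 1/(2L)` and `m` large enough that
`c = (1−νh)^m / (βμh(1−2Lh)) + 2(L−μ)h/(1−2Lh) < 1`, where
`β = ∑_{t=1}^m (1−νh)^{m−t}`, the S2GD iterates satisfy
`E[P(w^k) − P(w*)] ≤ c^k (P(w^0) − P(w*))` for every `k ≥ 0`. -/
theorem s2gd_linear_convergence_in_expectation
    (d n : ℕ) (hn : 0 < n)
    (f : Fin n → EuclideanSpace ℝ (Fin d) → ℝ)
    (f' : Fin n → EuclideanSpace ℝ (Fin d) → EuclideanSpace ℝ (Fin d))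
    (hgrad : ∀ i x, HasGradientAt (f i) (f' i x) x)
    (hconvex : ∀ i, ConvexOn ℝ Set.univ (f i))
    (L : ℝ) (hL : 0 < L)
    (hLip : ∀ i (x y : EuclideanSpace ℝ (Fin d)), ‖f' i x - f' i y‖ ≤ L * ‖x - y‖)
    (P : EuclideanSpace ℝ (Fin d) → ℝ)
    (hP : ∀ w, P w = (1 / (n : ℝ)) * ∑ i, f i w)
    (P' : EuclideanSpace ℝ (Fin d) → EuclideanSpace ℝ (Fin d))
    (hP' : ∀ w, P' w = (1 / (n : ℝ)) • ∑ i, f' i w)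
    (μ : ℝ) (hμ : 0 < μ) (hμL : μ ≤ L)
    (hstrong : ∀ x z : EuclideanSpace ℝ (Fin d),
      P x + ⟪P' x, z - x⟫ + μ / 2 * ‖z - x‖ ^ 2 ≤ P z)
    (wstar : EuclideanSpace ℝ (Fin d)) (hmin : ∀ w, P wstar ≤ P w)
    (m : ℕ) (hm : 1 ≤ m) (h ν : ℝ)
    (hν0 : 0 ≤ ν) (hνμ : ν ≤ μ) (hνh : ν * h < 1)
    (hh0 : 0 < h) (hhL : h < 1 / (2 * L))
    (β : ℝ) (hβ : β = ∑ t ∈ Finset.range m, (1 - ν * h) ^ (m - (t + 1)))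
    (c : ℝ)
    (hc : c = (1 - ν * h) ^ m / (β * μ * h * (1 - 2 * L * h))
        + 2 * (L - μ) * h / (1 - 2 * L * h))
    (hc1 : c < 1)
    (w0 : EuclideanSpace ℝ (Fin d)) (k : ℕ) :
    ∑ ω : Fin k → Fin m × (Fin m → Fin n),
        s2gdWeight n ν h β m ω * (P (s2gdIterate f' P' h m w0 k ω) - P wstar)
      ≤ c ^ k * (P w0 - P wstar) := by
  have hq0 : 0 < 1 - ν * h := by linarith
  have h2L : 0 < 1 - 2 * L * h := by
    rw [lt_div_iff₀ (by positivity)] at hhL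
    linarith
  have hβ0 : 0 < β := by
    rw [hβ]
    exact Finset.sum_pos (fun t _ => pow_pos hq0 _) (Finset.nonempty_range_iff.2 (by omega))
  have hc0 : 0 ≤ c := by
    rw [hc]
    have : 0 ≤ L - μ := by linarith
    positivity
  have hep := fun w => s2gd_epoch_bound hn hgrad hconvex hL hLip hP hP' hμ hstrong hmin
    hν0 hνμ hνh hh0 h2L hβ hβ0 hc w
  induction k generalizing w0 with
  | zero => simp [s2gdWeight, s2gdIterate]
  | succ k ih =>
    rw [s2gd_sum_cons]
    have hterm : ∀ (x : Fin m × (Fin m → Fin n)) (τ : Fin k → Fin m × (Fin m → Fin n)),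
        s2gdWeight n ν h β m (Fin.cons x τ : Fin (k + 1) → Fin m × (Fin m → Fin n))
          * (P (s2gdIterate f' P' h m w0 (k + 1) (Fin.cons x τ)) - P wstar)
        = ((1 - ν * h) ^ (m - ((x.1 : ℕ) + 1)) / β) * ((1 : ℝ) / (n : ℝ)) ^ m
          * (s2gdWeight n ν h β m τ
            * (P (s2gdIterate f' P' h m
                (s2gdEpoch f' P' h m w0 ((x.1 : ℕ) + 1) x.2) k τ) - P wstar)) := by
      intro x τ
      simp only [s2gdWeight, s2gdIterate, Fin.prod_univ_succ, Fin.cons_zero, Fin.cons_succ,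
        List.finRange_succ, List.foldl_cons, List.foldl_map]
      ring
    calc _ ≤ ∑ x : Fin m × (Fin m → Fin n),
          ((1 - ν * h) ^ (m - ((x.1 : ℕ) + 1)) / β) * ((1 : ℝ) / (n : ℝ)) ^ m
          * (c ^ k * (P (s2gdEpoch f' P' h m w0 ((x.1 : ℕ) + 1) x.2) - P wstar)) := by
          refine Finset.sum_le_sum fun x _ => ?_
          simp only [hterm]
          rw [← Finset.mul_sum]
          exact mul_le_mul_of_nonneg_left (ih _) (by positivity)
      _ = c ^ k * ∑ x : Fin m × (Fin m → Fin n),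
          ((1 - ν * h) ^ (m - ((x.1 : ℕ) + 1)) / β) * ((1 : ℝ) / (n : ℝ)) ^ m
          * (P (s2gdEpoch f' P' h m w0 ((x.1 : ℕ) + 1) x.2) - P wstar) := by
          rw [Finset.mul_sum]
          refine Finset.sum_congr rfl fun x _ => ?_
          ring
      _ ≤ c ^ k * (c * (P w0 - P wstar)) :=
          mul_le_mul_of_nonneg_left (hep w0) (pow_nonneg hc0 k)
      _ = _ := by rw [pow_succ]; ring
end
end

section
/- Consider the S2GD algorithm under the stated assumptions, with 0 ≤ ν ≤ μ, 0 < h < 1/(2L), and m ≥ 1 large enough that c := (1 − νh)^m / (β μ h (1 − 2Lh)) + 2(L − μ)h / (1 − 2Lh) < 1, where β := Σ_{t=1}^m (1 − νh)^{m−t}. Then for any 0 < ρ < 1, any 0 < ε < 1, and any integer k ≥ log(1/(ερ)) / log(1/c), one has Prob( P(w^k) − P(w*) ≤ ε (P(w^0) − P(w*)) ) ≥ 1 − ρ. -/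
open scoped RealInnerProductSpace BigOperators

noncomputable section

section Smooth

variable {E : Type*} [NormedAddCommGroup E] [InnerProductSpace ℝ E] [CompleteSpace E]

lemma aux_line_deriv (f : E → ℝ) (f' : E → E) (hg : ∀ x, HasGradientAt f (f' x) x) (x v : E)
    (t : ℝ) : HasDerivAt (fun s : ℝ => f (x + s • v)) ⟪f' (x + t • v), v⟫ t := by
  have h1 : HasDerivAt (fun s : ℝ => x + s • v) v t := by
    simpa using ((hasDerivAt_id t).smul_const v).const_add x
  have h2 := (hg (x + t • v)).hasFDerivAt.comp_hasDerivAt t h1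
  simpa [Function.comp_def] using h2

lemma aux_descent (f : E → ℝ) (f' : E → E) (hg : ∀ x, HasGradientAt f (f' x) x) (L : ℝ)
    (hLip : ∀ x y, ‖f' x - f' y‖ ≤ L * ‖x - y‖) (x v : E) :
    f (x + v) ≤ f x + ⟪f' x, v⟫ + L / 2 * ‖v‖ ^ 2 := by
  have hd : ∀ t : ℝ, HasDerivAt
      (fun s : ℝ => f (x + s • v) - s * ⟪f' x, v⟫ - L / 2 * ‖v‖ ^ 2 * s ^ 2)
      (⟪f' (x + t • v), v⟫ - 1 * ⟪f' x, v⟫ - L / 2 * ‖v‖ ^ 2 * (2 * t)) t := by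
    intro t
    have h3 : HasDerivAt (fun s : ℝ => s ^ 2) (2 * t) t := by
      simpa using hasDerivAt_pow 2 t
    exact ((aux_line_deriv f f' hg x v t).sub ((hasDerivAt_id t).mul_const _)).sub
      (h3.const_mul _)
  have hanti : AntitoneOn
      (fun s : ℝ => f (x + s • v) - s * ⟪f' x, v⟫ - L / 2 * ‖v‖ ^ 2 * s ^ 2)
      (Set.Icc 0 1) := by
    apply antitoneOn_of_deriv_nonpos (convex_Icc 0 1)
    · intro t _
      exact (hd t).continuousAt.continuousWithinAt
    · intro t _
      exact (hd t).differentiableAt.differentiableWithinAt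
    · intro t ht
      rw [interior_Icc] at ht
      rw [(hd t).deriv]
      have h4 : ⟪f' (x + t • v) - f' x, v⟫ ≤ L * (t * ‖v‖) * ‖v‖ := by
        refine (real_inner_le_norm _ _).trans ?_
        refine mul_le_mul_of_nonneg_right ?_ (norm_nonneg _)
        refine (hLip _ _).trans (le_of_eq ?_)
        rw [add_sub_cancel_left, norm_smul, Real.norm_of_nonneg ht.1.le]
      rw [inner_sub_left] at h4
      nlinarith
  have := hanti (Set.left_mem_Icc.2 zero_le_one) (Set.right_mem_Icc.2 zero_le_one) zero_le_one
  simp at this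
  linarith

lemma aux_first_order (f : E → ℝ) (f' : E → E) (hg : ∀ x, HasGradientAt f (f' x) x)
    (hc : ConvexOn ℝ Set.univ f) (x v : E) :
    f x + ⟪f' x, v⟫ ≤ f (x + v) := by
  have hc2 : ConvexOn ℝ Set.univ (fun s : ℝ => f (x + s • v)) := by
    refine ⟨convex_univ, ?_⟩
    intro a _ b _ p q hp hq hpq
    have := hc.2 (Set.mem_univ (x + a • v)) (Set.mem_univ (x + b • v)) hp hq hpq
    refine le_trans (le_of_eq ?_) this
    obtain rfl : p = 1 - q := by linarith
    have e : x + ((1 - q) • a + q • b) • v = (1 - q) • (x + a • v) + q • (x + b • v) := by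
      simp only [smul_eq_mul]
      module
    exact congrArg f e
  have := hc2.le_slope_of_hasDerivAt (Set.mem_univ 0) (Set.mem_univ 1) zero_lt_one
    (aux_line_deriv f f' hg x v 0)
  simp [slope_def_field] at this
  linarith

lemma aux_cocoercive (f : E → ℝ) (f' : E → E) (hg : ∀ x, HasGradientAt f (f' x) x)
    (hc : ConvexOn ℝ Set.univ f) (L : ℝ) (hL : 0 < L)
    (hLip : ∀ x y, ‖f' x - f' y‖ ≤ L * ‖x - y‖) (x z : E) :
    ‖f' x - f' z‖ ^ 2 ≤ 2 * L * (f x - f z - ⟪f' z, x - z⟫) := by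
  have h1 := aux_descent f f' hg L hLip x (-(1 / L) • (f' x - f' z))
  have h2 := aux_first_order f f' hg hc z ((x - z) + -(1 / L) • (f' x - f' z))
  have e : z + ((x - z) + -(1 / L) • (f' x - f' z)) = x + -(1 / L) • (f' x - f' z) := by abel
  rw [e] at h2
  rw [inner_add_right, inner_smul_right] at h2
  rw [inner_smul_right, norm_smul, mul_pow, Real.norm_eq_abs, sq_abs] at h1
  have e2 : ⟪f' x, f' x - f' z⟫ - ⟪f' z, f' x - f' z⟫ = ‖f' x - f' z‖ ^ 2 := by
    rw [← inner_sub_left, real_inner_self_eq_norm_sq]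
  have h3 : f z + ⟪f' z, x - z⟫ - f x ≤ -(1 / (2 * L)) * ‖f' x - f' z‖ ^ 2 := by
    have : L / 2 * ((-(1 / L)) ^ 2 * ‖f' x - f' z‖ ^ 2)
        = (1 / (2 * L)) * ‖f' x - f' z‖ ^ 2 := by field_simp
    have h5 : (1 / L) * ‖f' x - f' z‖ ^ 2 = 2 * ((1 / (2 * L)) * ‖f' x - f' z‖ ^ 2) := by
      field_simp
    rw [this] at h1
    rw [← e2] at h1 h5 ⊢
    linarith
  have h4 : ‖f' x - f' z‖ ^ 2 = 2 * L * ((1 / (2 * L)) * ‖f' x - f' z‖ ^ 2) := by field_simp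
  rw [h4]
  apply mul_le_mul_of_nonneg_left _ (by positivity)
  linarith

lemma aux_step {n : ℕ} (hn : 0 < n) (f : Fin n → E → ℝ) (f' : Fin n → E → E)
    (hgrad : ∀ i x, HasGradientAt (f i) (f' i x) x)
    (hconvex : ∀ i, ConvexOn ℝ Set.univ (f i))
    (L : ℝ) (hL : 0 < L)
    (hLip : ∀ i (x y : E), ‖f' i x - f' i y‖ ≤ L * ‖x - y‖)
    (P : E → ℝ) (hP : ∀ w, (n : ℝ) * P w = ∑ i, f i w)
    (P' : E → E) (hP' : ∀ w, (n : ℝ) • P' w = ∑ i, f' i w)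
    (μ : ℝ) (hμ : 0 < μ)
    (hstrong : ∀ x z : E, P x + ⟪P' x, z - x⟫ + μ / 2 * ‖z - x‖ ^ 2 ≤ P z)
    (ws : E) (hz : P' ws = 0) (h ν : ℝ) (hνμ : ν ≤ μ) (hh : 0 < h) (w y : E) :
    (1 / (n : ℝ)) * ∑ i, ‖y - h • (P' w + f' i y - f' i w) - ws‖ ^ 2
      ≤ (1 - ν * h) * ‖y - ws‖ ^ 2 - 2 * h * (1 - 2 * L * h) * (P y - P ws)
        + 4 * (L - μ) * h ^ 2 * (P w - P ws) := by
  have hn' : (0 : ℝ) < n := by exact_mod_cast hn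
  have hco : ∀ x, ∑ i, ‖f' i x - f' i ws‖ ^ 2 ≤ n * (2 * L * (P x - P ws)) := by
    intro x
    calc ∑ i, ‖f' i x - f' i ws‖ ^ 2
        ≤ ∑ i, 2 * L * (f i x - f i ws - ⟪f' i ws, x - ws⟫) :=
          Finset.sum_le_sum fun i _ =>
            aux_cocoercive (f i) (f' i) (hgrad i) (hconvex i) L hL (hLip i) x ws
      _ = 2 * L * (n * P x - n * P ws - ⟪(n : ℝ) • P' ws, x - ws⟫) := by
          rw [← Finset.mul_sum, Finset.sum_sub_distrib, Finset.sum_sub_distrib, hP, hP, hP',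
            sum_inner]
      _ = n * (2 * L * (P x - P ws)) := by rw [hz]; simp; ring
  have hPL : 2 * μ * (P w - P ws) ≤ ‖P' w‖ ^ 2 := by
    have h1 := hstrong w ws
    have h2 : 0 ≤ ‖P' w + μ • (ws - w)‖ ^ 2 := by positivity
    rw [norm_add_sq_real, inner_smul_right, norm_smul, mul_pow, Real.norm_eq_abs, sq_abs] at h2
    nlinarith
  have hb : ∑ i, ‖f' i w - f' i ws - P' w‖ ^ 2 ≤ n * (2 * (L - μ) * (P w - P ws)) := by
    have e : ∑ i, ‖f' i w - f' i ws - P' w‖ ^ 2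
        = ∑ i, ‖f' i w - f' i ws‖ ^ 2 - n * ‖P' w‖ ^ 2 := by
      simp_rw [norm_sub_sq_real (_ - _) (P' w)]
      rw [Finset.sum_add_distrib, Finset.sum_sub_distrib, ← Finset.mul_sum, ← sum_inner,
        Finset.sum_sub_distrib, ← hP', ← hP', hz, inner_sub_left, inner_smul_left]
      simp
      ring
    rw [e]
    have := hco w
    nlinarith
  have hv : ∑ i, ‖P' w + f' i y - f' i w‖ ^ 2
      ≤ n * (4 * L * (P y - P ws) + 4 * (L - μ) * (P w - P ws)) := by
    have : ∀ i, ‖P' w + f' i y - f' i w‖ ^ 2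
        ≤ 2 * ‖f' i y - f' i ws‖ ^ 2 + 2 * ‖f' i w - f' i ws - P' w‖ ^ 2 := by
      intro i
      have e : P' w + f' i y - f' i w = (f' i y - f' i ws) - (f' i w - f' i ws - P' w) := by
        abel
      rw [e]
      have := parallelogram_law_with_norm ℝ (f' i y - f' i ws) (f' i w - f' i ws - P' w)
      have h0 := sq_nonneg ‖(f' i y - f' i ws) + (f' i w - f' i ws - P' w)‖
      nlinarith
    have h1 := Finset.sum_le_sum (fun i (_ : i ∈ Finset.univ) => this i)
    rw [Finset.sum_add_distrib, ← Finset.mul_sum, ← Finset.mul_sum] at h1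
    have := hco y
    linarith
  have hmain : ∑ i, ‖y - h • (P' w + f' i y - f' i w) - ws‖ ^ 2
      = n * ‖y - ws‖ ^ 2 - 2 * h * (n * ⟪y - ws, P' y⟫)
        + h ^ 2 * ∑ i, ‖P' w + f' i y - f' i w‖ ^ 2 := by
    have e : ∀ i, ‖y - h • (P' w + f' i y - f' i w) - ws‖ ^ 2
        = ‖y - ws‖ ^ 2 - 2 * h * ⟪y - ws, P' w + f' i y - f' i w⟫
          + h ^ 2 * ‖P' w + f' i y - f' i w‖ ^ 2 := by
      intro i
      rw [sub_right_comm, norm_sub_sq_real, inner_smul_right, norm_smul, mul_pow,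
        Real.norm_eq_abs, sq_abs]
      ring
    simp_rw [e]
    rw [Finset.sum_add_distrib, Finset.sum_sub_distrib, ← Finset.mul_sum, ← Finset.mul_sum,
      ← inner_sum, Finset.sum_sub_distrib, Finset.sum_add_distrib, ← hP', ← hP']
    simp [inner_smul_right, ← Nat.cast_smul_eq_nsmul ℝ]
  have hs := hstrong y ws
  have hin : P y - P ws + ν / 2 * ‖y - ws‖ ^ 2 ≤ ⟪y - ws, P' y⟫ := by
    rw [← neg_sub y ws, inner_neg_right, norm_neg, real_inner_comm] at hs
    nlinarith [sq_nonneg ‖y - ws‖]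
  rw [hmain, one_div, inv_mul_le_iff₀ hn']
  have h1 := mul_le_mul_of_nonneg_left hv (sq_nonneg h)
  have h2 := mul_le_mul_of_nonneg_left hin (by positivity : 0 ≤ 2 * h * n)
  linarith

end Smooth

section Prob

variable {E ι : Type*} [Fintype ι]

lemma aux_peel (p : ι → ℝ) (k : ℕ) (S : Fin (k + 1) → ι → E → E) (G : E → ℝ) (y : E) :
    ∑ ω : Fin (k + 1) → ι, (∏ j, p (ω j)) *
        G ((List.finRange (k + 1)).foldl (fun y t => S t (ω t) y) y)
      = ∑ i, p i * ∑ ω : Fin k → ι, (∏ j, p (ω j)) *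
        G ((List.finRange k).foldl (fun y t => S t.succ (ω t) y) (S 0 i y)) := by
  rw [← (Fin.consEquiv (fun _ : Fin (k + 1) => ι)).sum_comp, Fintype.sum_prod_type]
  refine Finset.sum_congr rfl fun i _ => ?_
  rw [Finset.mul_sum]
  refine Finset.sum_congr rfl fun ω _ => ?_
  simp [Fin.consEquiv, Fin.prod_univ_succ, List.finRange_succ, List.foldl_map, mul_assoc]

lemma aux_super (p : ι → ℝ) (hp : ∀ i, 0 ≤ p i) (S : ι → E → E) (V : E → ℝ) (c : ℝ)
    (hc : 0 ≤ c) (hV : ∀ y, ∑ i, p i * V (S i y) ≤ c * V y) (k : ℕ) (y : E) :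
    ∑ ω : Fin k → ι, (∏ j, p (ω j)) *
        V ((List.finRange k).foldl (fun y t => S (ω t) y) y) ≤ c ^ k * V y := by
  induction k generalizing y with
  | zero => simp
  | succ k ih =>
    rw [aux_peel p k (fun _ => S) V y]
    calc _ ≤ ∑ i, p i * (c ^ k * V (S i y)) :=
          Finset.sum_le_sum fun i _ => mul_le_mul_of_nonneg_left (ih _) (hp i)
      _ = c ^ k * ∑ i, p i * V (S i y) := by
          rw [Finset.mul_sum]; exact Finset.sum_congr rfl fun i _ => by ring
      _ ≤ c ^ k * (c * V y) := mul_le_mul_of_nonneg_left (hV y) (pow_nonneg hc k)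
      _ = _ := by ring

/-- Expectation of `G` after `T` uniformly random steps. -/
def auxE {n : ℕ} (S : Fin n → E → E) (G : E → ℝ) : ℕ → E → ℝ
  | 0, y => G y
  | T + 1, y => (1 / (n : ℝ)) * ∑ i, auxE S G T (S i y)

lemma aux_epoch {n : ℕ} (hn : 0 < n) (S : Fin n → E → E) (G : E → ℝ) (m : ℕ) (T : ℕ)
    (hT : T ≤ m) (y : E) :
    ∑ σ : Fin m → Fin n, (∏ _j : Fin m, (1 / (n : ℝ))) *
      G ((List.finRange m).foldl (fun y (t : Fin m) => if (t : ℕ) < T then S (σ t) y else y) y)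
      = auxE S G T y := by
  have hn' : (n : ℝ) ≠ 0 := by exact_mod_cast hn.ne'
  induction m generalizing T y with
  | zero =>
    obtain rfl : T = 0 := by omega
    simp [auxE]
  | succ m ih =>
    have := aux_peel (E := E) (fun _ : Fin n => 1 / (n : ℝ)) m
      (fun t i y => if (t : ℕ) < T then S i y else y) G y
    rw [this]
    cases T with
    | zero =>
      have h0 := ih 0 (by omega) y
      simp only [not_lt_zero, if_false] at h0 ⊢
      rw [h0]
      simp [hn']
    | succ T =>
      simp only [Fin.val_succ, Fin.val_zero, Nat.succ_pos, if_true, add_lt_add_iff_right]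
      simp_rw [ih T (by omega)]
      rw [← Finset.mul_sum]
      rfl

lemma auxE_mono {n : ℕ} (S : Fin n → E → E) (G H : E → ℝ) (a : ℝ) (hGH : ∀ y, G y ≤ a * H y)
    (T : ℕ) (y : E) : auxE S G T y ≤ a * auxE S H T y := by
  induction T generalizing y with
  | zero => exact hGH y
  | succ T ih =>
    simp only [auxE]
    rw [mul_left_comm a, Finset.mul_sum _ _ a]
    exact mul_le_mul_of_nonneg_left (Finset.sum_le_sum fun i _ => ih _) (by positivity)

lemma auxE_nonneg {n : ℕ} (S : Fin n → E → E) (G : E → ℝ) (hG : ∀ y, 0 ≤ G y)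
    (T : ℕ) (y : E) : 0 ≤ auxE S G T y := by
  induction T generalizing y with
  | zero => exact hG y
  | succ T ih =>
    simp only [auxE]
    exact mul_nonneg (by positivity) (Finset.sum_nonneg fun i _ => ih _)

lemma auxE_rec {n : ℕ} (hn : 0 < n) (S : Fin n → E → E) (r F : E → ℝ) (q D K : ℝ)
    (hr : ∀ y, (1 / (n : ℝ)) * ∑ i, r (S i y) ≤ q * r y - D * F y + K) (T : ℕ) (y : E) :
    auxE S r (T + 1) y ≤ q * auxE S r T y - D * auxE S F T y + K := by
  have hn' : (n : ℝ) ≠ 0 := by exact_mod_cast hn.ne'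
  induction T generalizing y with
  | zero => exact hr y
  | succ T ih =>
    rw [auxE]
    calc _ ≤ (1 / (n : ℝ)) * ∑ i, (q * auxE S r T (S i y) - D * auxE S F T (S i y) + K) :=
          mul_le_mul_of_nonneg_left (Finset.sum_le_sum fun i _ => ih _) (by positivity)
      _ = _ := by
          simp only [auxE]
          rw [Finset.sum_add_distrib, Finset.sum_sub_distrib, ← Finset.mul_sum,
            ← Finset.mul_sum]
          simp
          field_simp

lemma aux_geom_succ (q : ℝ) (φ : ℕ → ℝ) (m : ℕ) :
    ∑ t ∈ Finset.range (m + 1), q ^ (m + 1 - (t + 1)) * φ t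
      = q * ∑ t ∈ Finset.range m, q ^ (m - (t + 1)) * φ t + φ m := by
  rw [Finset.sum_range_succ, Finset.mul_sum]
  congr 1
  · refine Finset.sum_congr rfl fun t ht => ?_
    have : m + 1 - (t + 1) = (m - (t + 1)) + 1 := by
      have := Finset.mem_range.1 ht; omega
    rw [this, pow_succ]; ring
  · simp

lemma aux_telescope (q D K : ℝ) (hq : 0 ≤ q) (a φ : ℕ → ℝ)
    (hrec : ∀ t, a (t + 1) ≤ q * a t - D * φ t + K) (m : ℕ) :
    a m + D * ∑ t ∈ Finset.range m, q ^ (m - (t + 1)) * φ t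
      ≤ q ^ m * a 0 + K * ∑ t ∈ Finset.range m, q ^ (m - (t + 1)) * 1 := by
  induction m with
  | zero => simp
  | succ m ih =>
    rw [aux_geom_succ, aux_geom_succ q (fun _ => 1)]
    have h1 := hrec m
    have h2 := mul_le_mul_of_nonneg_left ih hq
    rw [pow_succ]
    linarith

lemma aux_shift (q : ℝ) (φ : ℕ → ℝ) (m : ℕ) :
    ∑ t ∈ Finset.range m, q ^ (m - (t + 1)) * φ (t + 1)
      = φ m + q * ∑ t ∈ Finset.range m, q ^ (m - (t + 1)) * φ t - q ^ m * φ 0 := by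
  induction m with
  | zero => simp
  | succ m ih =>
    rw [aux_geom_succ q φ, aux_geom_succ q (fun t => φ (t + 1)), ih, pow_succ]
    ring

lemma aux_combine (q D K l : ℝ) (hq : 0 ≤ q) (hq1 : q ≤ 1) (hD : 0 ≤ D) (hDl : D * l ≤ q)
    (a φ : ℕ → ℝ) (ha : ∀ t, 0 ≤ a t) (hφ : ∀ t, 0 ≤ φ t) (hl : ∀ t, φ t ≤ l * a t)
    (hrec : ∀ t, a (t + 1) ≤ q * a t - D * φ t + K) (m : ℕ) :
    D * ∑ t ∈ Finset.range m, q ^ (m - (t + 1)) * φ (t + 1)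
      ≤ q ^ m * a 0 + K * ∑ t ∈ Finset.range m, q ^ (m - (t + 1)) := by
  have h1 := aux_telescope q D K hq a φ hrec m
  simp only [mul_one] at h1
  rw [aux_shift]
  set S0 := ∑ t ∈ Finset.range m, q ^ (m - (t + 1)) * φ t
  set R := q ^ m * a 0 + K * ∑ t ∈ Finset.range m, q ^ (m - (t + 1))
  have hS0 : 0 ≤ S0 := Finset.sum_nonneg fun t _ => mul_nonneg (pow_nonneg hq _) (hφ t)
  have hR : 0 ≤ R := le_trans (add_nonneg (ha m) (mul_nonneg hD hS0)) h1
  have h2 : D * φ m ≤ q * a m := by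
    calc D * φ m ≤ D * (l * a m) := mul_le_mul_of_nonneg_left (hl m) hD
      _ = (D * l) * a m := by ring
      _ ≤ _ := mul_le_mul_of_nonneg_right hDl (ha m)
  have h3 := mul_le_mul_of_nonneg_left h1 hq
  have h4 : 0 ≤ D * (q ^ m * φ 0) := mul_nonneg hD (mul_nonneg (pow_nonneg hq _) (hφ 0))
  have h5 : q * R ≤ R := by nlinarith
  nlinarith

lemma aux_markov {Ω : Type*} [Fintype Ω] (W X : Ω → ℝ) (hW : ∀ ω, 0 ≤ W ω)
    (hX : ∀ ω, 0 ≤ X ω) (hW1 : ∑ ω, W ω = 1) (A ε ρ : ℝ) (hA : 0 ≤ A) (hε : 0 < ε)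
    (hρ : 0 < ρ)
    (hE : ∑ ω, W ω * X ω ≤ ε * ρ * A) :
    1 - ρ ≤ ∑ ω, Set.indicator {ω' | X ω' ≤ ε * A} W ω := by
  classical
  have hsplit : ∑ ω, Set.indicator {ω' | X ω' ≤ ε * A} W ω
      + ∑ ω, Set.indicator {ω' | X ω' ≤ ε * A}ᶜ W ω = 1 := by
    rw [← Finset.sum_add_distrib, ← hW1]
    exact Finset.sum_congr rfl fun ω _ => Set.indicator_self_add_compl_apply _ _ _
  suffices hs : ∑ ω, Set.indicator {ω' | X ω' ≤ ε * A}ᶜ W ω ≤ ρ by linarith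
  rcases hA.eq_or_lt with h0 | hpos
  · subst h0
    have hz : ∑ ω, W ω * X ω = 0 :=
      le_antisymm (by simpa using hE) (Finset.sum_nonneg fun ω _ => mul_nonneg (hW ω) (hX ω))
    rw [Finset.sum_eq_zero_iff_of_nonneg (fun ω _ => mul_nonneg (hW ω) (hX ω))] at hz
    rw [Finset.sum_eq_zero]
    · exact hρ.le
    · intro ω hω
      by_cases hb : X ω ≤ ε * 0
      · simp only [Set.indicator, Set.mem_compl_iff, Set.mem_ofPred_eq, hb, not_true, if_false]
      · have := hz ω hω
        have hx : X ω ≠ 0 := by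
          intro hx; apply hb; rw [hx]; simp
        have : W ω = 0 := by simpa [hx] using this
        simp [Set.indicator, this]
  · have hEA : 0 < ε * A := mul_pos hε hpos
    have : (ε * A) * ∑ ω, Set.indicator {ω' | X ω' ≤ ε * A}ᶜ W ω ≤ (ε * A) * ρ := by
      refine le_trans ?_ (hE.trans (le_of_eq (by ring)))
      rw [Finset.mul_sum]
      refine Finset.sum_le_sum fun ω _ => ?_
      by_cases hb : X ω ≤ ε * A
      · simp only [Set.indicator, Set.mem_compl_iff, Set.mem_ofPred_eq, hb, not_true, if_false]
        simpa using mul_nonneg (hW ω) (hX ω)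
      · simp only [Set.indicator, Set.mem_compl_iff, Set.mem_ofPred_eq, hb, not_false_eq_true,
          if_true]
        rw [mul_comm]
        exact mul_le_mul_of_nonneg_left (not_le.1 hb).le (hW ω)
    exact le_of_mul_le_mul_left this hEA

end Prob

/-- **High-probability convergence of S2GD** (Theorem 2.5 of Konečný's thesis).
Under the assumptions of the S2GD convergence theorem (with convergence factor `c < 1`),
for any `0 < ρ < 1`, `0 < ε < 1` and any integer `k ≥ log(1/(ερ)) / log(1/c)`,
`Prob( P(w^k) − P(w*) ≤ ε (P(w^0) − P(w*)) ) ≥ 1 − ρ`. -/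
theorem s2gd_high_probability_convergence
    (d n : ℕ) (hn : 0 < n)
    (f : Fin n → EuclideanSpace ℝ (Fin d) → ℝ)
    (f' : Fin n → EuclideanSpace ℝ (Fin d) → EuclideanSpace ℝ (Fin d))
    (hgrad : ∀ i x, HasGradientAt (f i) (f' i x) x)
    (hconvex : ∀ i, ConvexOn ℝ Set.univ (f i))
    (L : ℝ) (hL : 0 < L)
    (hLip : ∀ i (x y : EuclideanSpace ℝ (Fin d)), ‖f' i x - f' i y‖ ≤ L * ‖x - y‖)
    (P : EuclideanSpace ℝ (Fin d) → ℝ)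
    (hP : ∀ w, P w = (1 / (n : ℝ)) * ∑ i, f i w)
    (P' : EuclideanSpace ℝ (Fin d) → EuclideanSpace ℝ (Fin d))
    (hP' : ∀ w, P' w = (1 / (n : ℝ)) • ∑ i, f' i w)
    (μ : ℝ) (hμ : 0 < μ) (hμL : μ ≤ L)
    (hstrong : ∀ x z : EuclideanSpace ℝ (Fin d),
      P x + ⟪P' x, z - x⟫ + μ / 2 * ‖z - x‖ ^ 2 ≤ P z)
    (wstar : EuclideanSpace ℝ (Fin d)) (hmin : ∀ w, P wstar ≤ P w)
    (m : ℕ) (hm : 1 ≤ m) (h ν : ℝ)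
    (hν0 : 0 ≤ ν) (hνμ : ν ≤ μ) (hνh : ν * h < 1)
    (hh0 : 0 < h) (hhL : h < 1 / (2 * L))
    (β : ℝ) (hβ : β = ∑ t ∈ Finset.range m, (1 - ν * h) ^ (m - (t + 1)))
    (c : ℝ)
    (hc : c = (1 - ν * h) ^ m / (β * μ * h * (1 - 2 * L * h))
        + 2 * (L - μ) * h / (1 - 2 * L * h))
    (hc1 : c < 1)
    (w0 : EuclideanSpace ℝ (Fin d))
    (ρ ε : ℝ) (hρ0 : 0 < ρ) (hρ1 : ρ < 1) (hε0 : 0 < ε) (hε1 : ε < 1)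
    (k : ℕ) (hk : Real.log (1 / (ε * ρ)) / Real.log (1 / c) ≤ (k : ℝ)) :
    1 - ρ ≤
      ∑ ω : Fin k → Fin m × (Fin m → Fin n),
        Set.indicator
          {ω' | P (s2gdIterate f' P' h m w0 k ω') - P wstar ≤ ε * (P w0 - P wstar)}
          (fun ω' => s2gdWeight n ν h β m ω') ω := by
  have hn' : (0 : ℝ) < n := by exact_mod_cast hn
  have hPn : ∀ w, (n : ℝ) * P w = ∑ i, f i w := by
    intro w; rw [hP]; field_simp
  have hPn' : ∀ w, (n : ℝ) • P' w = ∑ i, f' i w := by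
    intro w; rw [hP', smul_smul, mul_one_div_cancel hn'.ne', one_smul]
  have hLh : 2 * L * h < 1 := by
    rw [lt_div_iff₀ (by positivity)] at hhL; linarith
  -- descent for P
  have hdesc : ∀ x v, P (x + v) ≤ P x + ⟪P' x, v⟫ + L / 2 * ‖v‖ ^ 2 := by
    intro x v
    have h1 := Finset.sum_le_sum fun i (_ : i ∈ Finset.univ) =>
      aux_descent (f i) (f' i) (hgrad i) L (hLip i) x v
    rw [Finset.sum_add_distrib, Finset.sum_add_distrib, ← hPn, ← hPn, ← sum_inner, ← hPn',
      inner_smul_left] at h1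
    simp only [Finset.sum_const, Finset.card_univ, Fintype.card_fin, nsmul_eq_mul] at h1
    have h2 : (n : ℝ) * P (x + v) ≤ n * (P x + ⟪P' x, v⟫ + L / 2 * ‖v‖ ^ 2) := by
      refine h1.trans (le_of_eq ?_)
      simp
      ring
    exact le_of_mul_le_mul_left h2 hn'
  have hz : P' wstar = 0 := by
    have h1 := hdesc wstar (-(1 / L) • P' wstar)
    have h2 := hmin (wstar + -(1 / L) • P' wstar)
    rw [inner_smul_right, norm_smul, mul_pow, Real.norm_eq_abs, sq_abs,
      real_inner_self_eq_norm_sq] at h1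
    have h3 : L / 2 * ((-(1 / L)) ^ 2 * ‖P' wstar‖ ^ 2) = (1 / L) * ‖P' wstar‖ ^ 2 / 2 := by
      field_simp
    have h4 : (1 / L) * ‖P' wstar‖ ^ 2 ≤ 0 := by rw [h3] at h1; linarith
    have h5 : ‖P' wstar‖ ^ 2 ≤ 0 := by
      by_contra hcon
      push Not at hcon
      have : 0 < (1 / L) * ‖P' wstar‖ ^ 2 := by positivity
      linarith
    have h6 : ‖P' wstar‖ ^ 2 = 0 := le_antisymm h5 (by positivity)
    simpa using h6
  have hF0 : ∀ w, 0 ≤ P w - P wstar := fun w => sub_nonneg.2 (hmin w)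
  have hFr : ∀ w, P w - P wstar ≤ L / 2 * ‖w - wstar‖ ^ 2 := by
    intro w
    have := hdesc wstar (w - wstar)
    rw [hz, inner_zero_left, add_sub_cancel] at this
    linarith
  have hrF : ∀ w, ‖w - wstar‖ ^ 2 ≤ 2 / μ * (P w - P wstar) := by
    intro w
    have := hstrong wstar w
    rw [hz, inner_zero_left] at this
    rw [div_mul_eq_mul_div, le_div_iff₀ hμ]
    linarith
  set q : ℝ := 1 - ν * h with hqdef
  have hq0 : 0 < q := by simp only [hqdef]; linarith
  have hq1 : q ≤ 1 := by
    have := mul_nonneg hν0 hh0.le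
    simp only [hqdef]; linarith
  have hβ0 : 0 < β := by
    rw [hβ]
    exact Finset.sum_pos (fun t _ => pow_pos hq0 _) ⟨0, Finset.mem_range.2 hm⟩
  have h2Lh : 0 < 1 - 2 * L * h := by linarith
  have hc0 : 0 < c := by
    rw [hc]
    have : 0 ≤ 2 * (L - μ) * h / (1 - 2 * L * h) :=
      div_nonneg (mul_nonneg (mul_nonneg zero_le_two (by linarith)) hh0.le) h2Lh.le
    have : 0 < q ^ m / (β * μ * h * (1 - 2 * L * h)) := by positivity
    linarith
  -- one epoch
  let p : Fin m × (Fin m → Fin n) → ℝ :=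
    fun s => (q ^ (m - ((s.1 : ℕ) + 1)) / β) * ((1 : ℝ) / (n : ℝ)) ^ m
  have hp0 : ∀ s, 0 ≤ p s := fun s => by
    have := pow_pos hq0 (m - ((s.1 : ℕ) + 1))
    positivity
  have hexp : ∀ (G : EuclideanSpace ℝ (Fin d) → ℝ) (w : EuclideanSpace ℝ (Fin d)),
      ∑ s, p s * G (s2gdEpoch f' P' h m w ((s.1 : ℕ) + 1) s.2)
      = (∑ t ∈ Finset.range m, q ^ (m - (t + 1)) *
          auxE (s2gdInnerStep f' h w (P' w)) G (t + 1) w) / β := by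
    intro G w
    rw [Fintype.sum_prod_type, Finset.sum_div, Finset.sum_range]
    refine Finset.sum_congr rfl fun T _ => ?_
    rw [← aux_epoch hn (s2gdInnerStep f' h w (P' w)) G m (T + 1) (by omega) w,
      Finset.mul_sum, Finset.sum_div]
    refine Finset.sum_congr rfl fun σ _ => ?_
    simp only [p, s2gdEpoch, Finset.prod_const, Finset.card_univ, Fintype.card_fin]
    ring
  have hp1 : ∑ s, p s = 1 := by
    have h1 := hexp (fun _ => 1) w0
    have h2 : ∀ T y, auxE (s2gdInnerStep f' h w0 (P' w0)) (fun _ => (1 : ℝ)) T y = 1 := by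
      intro T
      induction T with
      | zero => intro y; rfl
      | succ T ih =>
        intro y
        simp only [auxE, ih]
        simp [hn'.ne']
    simp only [h2, mul_one] at h1
    rw [h1, ← hβ, div_self hβ0.ne']
  have hepoch : ∀ w, ∑ s, p s * (P (s2gdEpoch f' P' h m w ((s.1 : ℕ) + 1) s.2) - P wstar)
      ≤ c * (P w - P wstar) := by
    intro w
    rw [hexp (fun y => P y - P wstar) w]
    have hrec := auxE_rec hn (s2gdInnerStep f' h w (P' w)) (fun y => ‖y - wstar‖ ^ 2)
      (fun y => P y - P wstar) q (2 * h * (1 - 2 * L * h))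
      (4 * (L - μ) * h ^ 2 * (P w - P wstar))
      (fun y => aux_step hn f f' hgrad hconvex L hL hLip P hPn P' hPn' μ hμ hstrong wstar hz
        h ν hνμ hh0 w y)
    have hDl : 2 * h * (1 - 2 * L * h) * (L / 2) ≤ q := by
      have h1 : ν * h ≤ L * h := mul_le_mul_of_nonneg_right (hνμ.trans hμL) hh0.le
      have h2 : 0 ≤ L * h := by positivity
      simp only [hqdef]
      nlinarith
    have hcomb := aux_combine q (2 * h * (1 - 2 * L * h))
      (4 * (L - μ) * h ^ 2 * (P w - P wstar)) (L / 2) hq0.le hq1 (by positivity) hDl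
      (fun t => auxE (s2gdInnerStep f' h w (P' w)) (fun y => ‖y - wstar‖ ^ 2) t w)
      (fun t => auxE (s2gdInnerStep f' h w (P' w)) (fun y => P y - P wstar) t w)
      (fun t => auxE_nonneg _ _ (fun y => by positivity) t w)
      (fun t => auxE_nonneg _ _ hF0 t w)
      (fun t => auxE_mono _ _ _ _ hFr t w)
      (fun t => hrec t w) m
    rw [← hβ] at hcomb
    have hr0 : auxE (s2gdInnerStep f' h w (P' w)) (fun y => ‖y - wstar‖ ^ 2) 0 w
      ≤ 2 / μ * (P w - P wstar) := hrF w
    have h1 := mul_le_mul_of_nonneg_left hr0 (pow_nonneg hq0.le m)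
    rw [div_le_iff₀ hβ0]
    have hD : 0 < 2 * h * (1 - 2 * L * h) := by positivity
    refine le_of_mul_le_mul_left (hcomb.trans ((add_le_add_left h1 _).trans (le_of_eq ?_))) hD
    rw [hc]
    field_simp
    ring
  have hiter := aux_super p hp0
    (fun s w => s2gdEpoch f' P' h m w ((s.1 : ℕ) + 1) s.2) (fun w => P w - P wstar) c hc0.le
    hepoch k w0
  have hck : c ^ k ≤ ε * ρ := by
    have hlc : 0 < Real.log (1 / c) := Real.log_pos (by rw [lt_div_iff₀ hc0]; linarith)
    rw [div_le_iff₀ hlc, one_div, one_div, Real.log_inv, Real.log_inv] at hk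
    rw [← Real.log_le_log_iff (pow_pos hc0 k) (mul_pos hε0 hρ0), Real.log_pow]
    linarith
  refine aux_markov (fun ω => s2gdWeight n ν h β m ω)
    (fun ω => P (s2gdIterate f' P' h m w0 k ω) - P wstar)
    (fun ω => Finset.prod_nonneg fun j _ => hp0 (ω j)) (fun ω => hF0 _) ?_
    (P w0 - P wstar) ε ρ (hF0 w0) hε0 hρ0
    (le_trans hiter (mul_le_mul_of_nonneg_right hck (hF0 w0)))
  have : ∑ ω : Fin k → Fin m × (Fin m → Fin n), ∏ j, p (ω j) = 1 := by
    rw [← Fintype.prod_sum (fun (_ : Fin k) s => p s)]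
    simp [hp1]
  exact this
end
end

section
/- Under the stated assumptions, for any w, w̃ ∈ ℝ^d, if the index i is drawn uniformly at random from {1, …, n}, then E_i[ ‖∇f_i(w) − ∇f_i(w̃) + ∇P(w̃)‖² ] ≤ 4L ( P(w) − P(w*) ) + 4(L − μ) ( P(w̃) − P(w*) ). -/
open scoped RealInnerProductSpace BigOperators

namespace S2GD
variable {E : Type*} [NormedAddCommGroup E] [InnerProductSpace ℝ E] [CompleteSpace E]

lemma line_deriv (f : E → ℝ) (f' : E → E) (h : ∀ x, HasGradientAt f (f' x) x) (x v : E) (t : ℝ) :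
    HasDerivAt (fun s : ℝ => f (x + s • v)) ⟪f' (x + t • v), v⟫ t := by
  have h1 : HasDerivAt (fun s : ℝ => x + s • v) v t := by
    simpa using ((hasDerivAt_id t).smul_const v).const_add x
  have h2 := (h (x + t • v)).hasFDerivAt.comp_hasDerivAt t h1
  simpa [Function.comp_def] using h2

lemma descent (f : E → ℝ) (f' : E → E) (h : ∀ x, HasGradientAt f (f' x) x) (L : ℝ)
    (hLip : ∀ x y, ‖f' x - f' y‖ ≤ L * ‖x - y‖) (x v : E) :
    f (x + v) ≤ f x + ⟪f' x, v⟫ + L / 2 * ‖v‖ ^ 2 := by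
  have hd : ∀ t : ℝ, HasDerivAt
      (fun s : ℝ => f (x + s • v) - s * ⟪f' x, v⟫ - L / 2 * ‖v‖ ^ 2 * s ^ 2)
      (⟪f' (x + t • v), v⟫ - ⟪f' x, v⟫ - L * ‖v‖ ^ 2 * t) t := by
    intro t
    have h1 := ((line_deriv f f' h x v t).sub ((hasDerivAt_id t).mul_const ⟪f' x, v⟫)).sub
      (((hasDerivAt_id t).pow 2).const_mul (L / 2 * ‖v‖ ^ 2))
    refine h1.congr_deriv ?_
    simp
    ring
  have ha : AntitoneOn
      (fun s : ℝ => f (x + s • v) - s * ⟪f' x, v⟫ - L / 2 * ‖v‖ ^ 2 * s ^ 2) (Set.Icc 0 1) := by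
    apply antitoneOn_of_deriv_nonpos (convex_Icc 0 1)
    · exact fun t _ => (hd t).continuousAt.continuousWithinAt
    · exact fun t _ => (hd t).differentiableAt.differentiableWithinAt
    · intro t ht
      rw [interior_Icc] at ht
      rw [(hd t).deriv, ← inner_sub_left]
      have h1 := real_inner_le_norm (f' (x + t • v) - f' x) v
      have h2 := hLip (x + t • v) x
      rw [add_sub_cancel_left, norm_smul, Real.norm_of_nonneg ht.1.le] at h2
      have h3 := mul_le_mul_of_nonneg_right h2 (norm_nonneg v)
      nlinarith
  have := ha (a := 0) (b := 1) (by simp) (by simp) zero_le_one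
  simp at this
  linarith

lemma first_order (f : E → ℝ) (f' : E → E) (h : ∀ x, HasGradientAt f (f' x) x)
    (hc : ConvexOn ℝ Set.univ f) (x y : E) : f x + ⟪f' x, y - x⟫ ≤ f y := by
  have hg : ConvexOn ℝ Set.univ (fun s : ℝ => f (x + s • (y - x))) := by
    have := hc.comp_affineMap (AffineMap.lineMap x y : ℝ →ᵃ[ℝ] E)
    simpa [Function.comp_def, AffineMap.lineMap_apply, add_comm] using this
  have h1 := hg.le_slope_of_hasDerivAt (Set.mem_univ 0) (Set.mem_univ 1) zero_lt_one
    (line_deriv f f' h x (y - x) 0)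
  simp [slope_def_field] at h1
  linarith

lemma coco (f : E → ℝ) (f' : E → E) (h : ∀ x, HasGradientAt f (f' x) x)
    (hc : ConvexOn ℝ Set.univ f) (L : ℝ) (hL : 0 < L)
    (hLip : ∀ x y, ‖f' x - f' y‖ ≤ L * ‖x - y‖) (x y : E) :
    ‖f' x - f' y‖ ^ 2 ≤ 2 * L * (f x - f y - ⟪f' y, x - y⟫) := by
  have h1 := descent f f' h L hLip x (-(1 / L) • (f' x - f' y))
  have h2 := first_order f f' h hc y (x + -(1 / L) • (f' x - f' y))
  have e : x + -(1 / L) • (f' x - f' y) - y = (x - y) + -(1 / L) • (f' x - f' y) := by abel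
  rw [e, inner_add_right, inner_smul_right] at h2
  rw [inner_smul_right, norm_smul, mul_pow, Real.norm_eq_abs, sq_abs] at h1
  have h3 : ‖f' x - f' y‖ ^ 2 = ⟪f' x, f' x - f' y⟫ - ⟪f' y, f' x - f' y⟫ := by
    rw [← inner_sub_left, real_inner_self_eq_norm_sq]
  have h4 : L / 2 * ((-(1 / L)) ^ 2 * ‖f' x - f' y‖ ^ 2) = 1 / L * ‖f' x - f' y‖ ^ 2 / 2 := by
    field_simp
  rw [h4] at h1
  have h5 : 1 / L * ‖f' x - f' y‖ ^ 2 =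
    1 / L * ⟪f' x, f' x - f' y⟫ - 1 / L * ⟪f' y, f' x - f' y⟫ := by rw [h3]; ring
  have h6 : 1 / L * ‖f' x - f' y‖ ^ 2 ≤ 2 * (f x - f y - ⟪f' y, x - y⟫) := by linarith
  have h7 := mul_le_mul_of_nonneg_left h6 hL.le
  have h8 : L * (1 / L * ‖f' x - f' y‖ ^ 2) = ‖f' x - f' y‖ ^ 2 := by field_simp
  linarith

lemma two_sq (a b : E) : ‖a - b‖ ^ 2 ≤ 2 * ‖a‖ ^ 2 + 2 * ‖b‖ ^ 2 := by
  have := parallelogram_law_with_norm ℝ a b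
  nlinarith [sq_nonneg ‖a + b‖]

end S2GD

/-- **Bound on the second moment of the S2GD stochastic gradient estimate.**
Let `f 1, …, f n : ℝ^d → ℝ` be convex differentiable functions with `L`-Lipschitz gradients,
let `P` be their average, assume `P` is `μ`-strongly convex (necessarily `μ ≤ L`) with
minimizer `wstar`.  Then for any `w, wt` and `i` uniform on `{1, …, n}`,
`E_i ‖∇f_i(w) − ∇f_i(wt) + ∇P(wt)‖² ≤ 4L (P(w) − P(w*)) + 4(L − μ)(P(wt) − P(w*))`. -/
theorem s2gd_variance_bound
    (d n : ℕ) (hn : 0 < n)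
    (f : Fin n → EuclideanSpace ℝ (Fin d) → ℝ)
    (f' : Fin n → EuclideanSpace ℝ (Fin d) → EuclideanSpace ℝ (Fin d))
    (hgrad : ∀ i x, HasGradientAt (f i) (f' i x) x)
    (hconvex : ∀ i, ConvexOn ℝ Set.univ (f i))
    (L : ℝ) (hL : 0 < L)
    (hLip : ∀ i (x y : EuclideanSpace ℝ (Fin d)), ‖f' i x - f' i y‖ ≤ L * ‖x - y‖)
    (P : EuclideanSpace ℝ (Fin d) → ℝ)
    (hP : ∀ w, P w = (1 / (n : ℝ)) * ∑ i, f i w)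
    (P' : EuclideanSpace ℝ (Fin d) → EuclideanSpace ℝ (Fin d))
    (hP' : ∀ w, P' w = (1 / (n : ℝ)) • ∑ i, f' i w)
    (μ : ℝ) (hμ : 0 < μ) (hμL : μ ≤ L)
    (hstrong : ∀ x z : EuclideanSpace ℝ (Fin d),
      P x + ⟪P' x, z - x⟫ + μ / 2 * ‖z - x‖ ^ 2 ≤ P z)
    (wstar : EuclideanSpace ℝ (Fin d)) (hmin : ∀ w, P wstar ≤ P w)
    (w wt : EuclideanSpace ℝ (Fin d)) :
    (1 / (n : ℝ)) * ∑ i, ‖f' i w - f' i wt + P' wt‖ ^ 2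
      ≤ 4 * L * (P w - P wstar) + 4 * (L - μ) * (P wt - P wstar) := by
  have hn0 : (n : ℝ) ≠ 0 := by positivity
  have hinner : ∀ x v, ⟪P' x, v⟫ = (1 / (n : ℝ)) * ∑ i, ⟪f' i x, v⟫ := by
    intro x v
    rw [hP', real_inner_smul_left, sum_inner]
  -- averaged descent inequality
  have hdesc : ∀ x v, P (x + v) ≤ P x + ⟪P' x, v⟫ + L / 2 * ‖v‖ ^ 2 := by
    intro x v
    have h1 : ∑ i, f i (x + v) ≤ ∑ i, (f i x + ⟪f' i x, v⟫ + L / 2 * ‖v‖ ^ 2) :=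
      Finset.sum_le_sum fun i _ => S2GD.descent (f i) (f' i) (hgrad i) L (hLip i) x v
    have h2 := mul_le_mul_of_nonneg_left h1 (by positivity : 0 ≤ 1 / (n : ℝ))
    rw [hP, hP, hinner]
    refine h2.trans (le_of_eq ?_)
    simp only [Finset.sum_add_distrib, Finset.sum_const, Finset.card_univ, Fintype.card_fin,
      nsmul_eq_mul]
    field_simp
  have hstar : P' wstar = 0 := by
    have h1 := hdesc wstar (-(1 / L) • P' wstar)
    have h2 := hmin (wstar + -(1 / L) • P' wstar)
    rw [inner_smul_right, norm_smul, mul_pow, Real.norm_eq_abs, sq_abs,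
      real_inner_self_eq_norm_sq] at h1
    have h4 : L / 2 * ((-(1 / L)) ^ 2 * ‖P' wstar‖ ^ 2) = 1 / L * ‖P' wstar‖ ^ 2 / 2 := by
      field_simp
    have h5 : 1 / L * ‖P' wstar‖ ^ 2 ≤ 0 := by linarith
    have h6 : 0 < 1 / L := by positivity
    have h7 : ‖P' wstar‖ ^ 2 ≤ 0 := by
      by_contra h
      push Not at h
      linarith [mul_pos h6 h]
    have h8 : ‖P' wstar‖ = 0 := pow_eq_zero_iff two_ne_zero |>.1 (le_antisymm h7 (sq_nonneg _))
    exact norm_eq_zero.1 h8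
  have hvar : ∀ x, (1 / (n : ℝ)) * ∑ i, ‖f' i x - f' i wstar‖ ^ 2 ≤ 2 * L * (P x - P wstar) := by
    intro x
    have h1 : ∑ i, ‖f' i x - f' i wstar‖ ^ 2 ≤
        ∑ i, 2 * L * (f i x - f i wstar - ⟪f' i wstar, x - wstar⟫) :=
      Finset.sum_le_sum fun i _ =>
        S2GD.coco (f i) (f' i) (hgrad i) (hconvex i) L hL (hLip i) x wstar
    have h2 := mul_le_mul_of_nonneg_left h1 (by positivity : 0 ≤ 1 / (n : ℝ))
    have h3 := hinner wstar (x - wstar)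
    rw [hstar, inner_zero_left] at h3
    refine h2.trans (le_of_eq ?_)
    rw [hP, hP, ← Finset.mul_sum, Finset.sum_sub_distrib, Finset.sum_sub_distrib]
    linear_combination (2 * L) * h3
  have hPL : 2 * μ * (P wt - P wstar) ≤ ‖P' wt‖ ^ 2 := by
    have h1 := hstrong wt wstar
    have h2 := norm_add_sq_real (P' wt) (μ • (wstar - wt))
    rw [inner_smul_right, norm_smul, mul_pow, Real.norm_eq_abs, sq_abs] at h2
    have h3 := sq_nonneg ‖P' wt + μ • (wstar - wt)‖
    have h4 := mul_le_mul_of_nonneg_left h1 (by positivity : 0 ≤ 2 * μ)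
    nlinarith
  have hsecond : (1 / (n : ℝ)) * ∑ i, ‖f' i wt - f' i wstar - P' wt‖ ^ 2 =
      (1 / (n : ℝ)) * ∑ i, ‖f' i wt - f' i wstar‖ ^ 2 - ‖P' wt‖ ^ 2 := by
    have h1 := hinner wt (P' wt)
    have h2 := hinner wstar (P' wt)
    rw [hstar, inner_zero_left] at h2
    rw [real_inner_self_eq_norm_sq] at h1
    simp only [norm_sub_sq_real (_ - _) (P' wt), inner_sub_left, Finset.sum_add_distrib,
      Finset.sum_sub_distrib, ← Finset.mul_sum, Finset.sum_const, Finset.card_univ,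
      Fintype.card_fin, nsmul_eq_mul]
    have h3 : (1 / (n : ℝ)) * (n * ‖P' wt‖ ^ 2) = ‖P' wt‖ ^ 2 := by field_simp
    linear_combination h3 + 2 * h1 - 2 * h2
  have hsplit : (1 / (n : ℝ)) * ∑ i, ‖f' i w - f' i wt + P' wt‖ ^ 2 ≤
      2 * ((1 / (n : ℝ)) * ∑ i, ‖f' i w - f' i wstar‖ ^ 2) +
      2 * ((1 / (n : ℝ)) * ∑ i, ‖f' i wt - f' i wstar - P' wt‖ ^ 2) := by
    have h1 : ∑ i, ‖f' i w - f' i wt + P' wt‖ ^ 2 ≤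
        ∑ i, (2 * ‖f' i w - f' i wstar‖ ^ 2 + 2 * ‖f' i wt - f' i wstar - P' wt‖ ^ 2) := by
      refine Finset.sum_le_sum fun i _ => ?_
      have e : f' i w - f' i wt + P' wt =
        (f' i w - f' i wstar) - (f' i wt - f' i wstar - P' wt) := by abel
      rw [e]
      exact S2GD.two_sq _ _
    have h2 := mul_le_mul_of_nonneg_left h1 (by positivity : 0 ≤ 1 / (n : ℝ))
    refine h2.trans (le_of_eq ?_)
    rw [Finset.sum_add_distrib, ← Finset.mul_sum, ← Finset.mul_sum]
    ring
  have a1 := hvar w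
  have a2 := hvar wt
  rw [hsecond] at hsplit
  linarith
end

section
/- Choose μ > 0, 0 ≤ ν ≤ μ, 0 < h < 1/(2(L+μ)), and m ≥ 1 large enough that ĉ := (1 − νh)^m / (β μ h (1 − 2(L+μ)h)) + 2Lh / (1 − 2(L+μ)h) < 1, where β := Σ_{t=1}^m (1 − νh)^{m−t}. Let ŵ^0 = w^0, ŵ^1, ŵ^2, … be the iterates produced by S2GD applied to the perturbed problem. Then for any 0 < ρ < 1, any 0 < ε < 1, and any integer k ≥ log(1/(ερ)) / log(1/ĉ), one has Prob( P(ŵ^k) − P(w*) ≤ ε (P(w^0) − P(w*)) + (μ/2)‖w^0 − w*‖² ) ≥ 1 − ρ. -/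
open scoped RealInnerProductSpace BigOperators

noncomputable section

/-! ### First-order inequalities -/

theorem s2aux_first_order {d : ℕ} (f : EuclideanSpace ℝ (Fin d) → ℝ)
    (f' : EuclideanSpace ℝ (Fin d) → EuclideanSpace ℝ (Fin d))
    (hgrad : ∀ x, HasGradientAt f (f' x) x) (hconvex : ConvexOn ℝ Set.univ f)
    (x y : EuclideanSpace ℝ (Fin d)) : f x + ⟪f' x, y - x⟫ ≤ f y := by
  have hline : HasDerivAt (fun t : ℝ => x + t • (y - x)) (y - x) 0 := by
    have := ((hasDerivAt_id (0 : ℝ)).smul_const (y - x)).const_add x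
    simpa using this
  have hd : HasDerivAt (fun t : ℝ => f (x + t • (y - x))) ⟪f' x, y - x⟫ 0 := by
    have h1 := (hgrad x).hasFDerivAt
    have h2 : HasFDerivAt f ((InnerProductSpace.toDual ℝ _) (f' x)) (x + (0 : ℝ) • (y - x)) := by
      simpa using h1
    have h3 := h2.comp_hasDerivAt (0 : ℝ) hline
    rw [InnerProductSpace.toDual_apply_apply] at h3
    exact h3
  have hconv : ConvexOn ℝ Set.univ (fun t : ℝ => f (x + t • (y - x))) := by
    refine ⟨convex_univ, fun a _ b _ s t hs ht hst => ?_⟩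
    have := hconvex.2 (Set.mem_univ (x + a • (y - x))) (Set.mem_univ (x + b • (y - x))) hs ht hst
    have e : x + (s • a + t • b) • (y - x)
        = s • (x + a • (y - x)) + t • (x + b • (y - x)) := by
      obtain rfl : t = 1 - s := by linarith
      simp only [smul_eq_mul]
      module
    rw [← e] at this
    exact this
  have := hconv.le_slope_of_hasDerivAt (Set.mem_univ 0) (Set.mem_univ 1) one_pos hd
  simp [slope_def_field] at this
  linarith

theorem s2aux_descent {d : ℕ} (f : EuclideanSpace ℝ (Fin d) → ℝ)
    (f' : EuclideanSpace ℝ (Fin d) → EuclideanSpace ℝ (Fin d))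
    (hgrad : ∀ x, HasGradientAt f (f' x) x) (L : ℝ)
    (hLip : ∀ x y, ‖f' x - f' y‖ ≤ L * ‖x - y‖)
    (x y : EuclideanSpace ℝ (Fin d)) :
    f y ≤ f x + ⟪f' x, y - x⟫ + L / 2 * ‖y - x‖ ^ 2 := by
  set v := y - x with hv
  have hd : ∀ t : ℝ, HasDerivAt
      (fun t : ℝ => f (x + t • v) - t * ⟪f' x, v⟫ - L / 2 * ‖v‖ ^ 2 * t ^ 2)
      (⟪f' (x + t • v), v⟫ - ⟪f' x, v⟫ - L * ‖v‖ ^ 2 * t) t := by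
    intro t
    have hline : HasDerivAt (fun t : ℝ => x + t • v) v t := by
      have := ((hasDerivAt_id t).smul_const v).const_add x
      simpa using this
    have h1 : HasDerivAt (fun t : ℝ => f (x + t • v)) ⟪f' (x + t • v), v⟫ t := by
      have h3 := (hgrad (x + t • v)).hasFDerivAt.comp_hasDerivAt t hline
      rw [InnerProductSpace.toDual_apply_apply] at h3
      exact h3
    have h2 : HasDerivAt (fun t : ℝ => t * ⟪f' x, v⟫) ⟪f' x, v⟫ t := by
      simpa using (hasDerivAt_id t).mul_const ⟪f' x, v⟫
    have h3 : HasDerivAt (fun t : ℝ => L / 2 * ‖v‖ ^ 2 * t ^ 2) (L * ‖v‖ ^ 2 * t) t := by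
      have h4 := (hasDerivAt_pow 2 t).const_mul (L / 2 * ‖v‖ ^ 2)
      have e : L / 2 * ‖v‖ ^ 2 * (((2 : ℕ) : ℝ) * t ^ (2 - 1)) = L * ‖v‖ ^ 2 * t := by
        norm_num
        ring
      rw [e] at h4
      exact h4
    exact (h1.sub h2).sub h3
  have hanti : AntitoneOn
      (fun t : ℝ => f (x + t • v) - t * ⟪f' x, v⟫ - L / 2 * ‖v‖ ^ 2 * t ^ 2) (Set.Icc 0 1) := by
    apply antitoneOn_of_deriv_nonpos (convex_Icc 0 1)
    · exact fun t _ => (hd t).continuousAt.continuousWithinAt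
    · exact fun t _ => (hd t).differentiableAt.differentiableWithinAt
    · intro t ht
      rw [(hd t).deriv]
      rw [interior_Icc] at ht
      have h1 : ⟪f' (x + t • v) - f' x, v⟫ ≤ ‖f' (x + t • v) - f' x‖ * ‖v‖ :=
        real_inner_le_norm _ _
      have h2 := hLip (x + t • v) x
      rw [add_sub_cancel_left, norm_smul, Real.norm_of_nonneg ht.1.le] at h2
      have h3 := mul_le_mul_of_nonneg_right h2 (norm_nonneg v)
      rw [inner_sub_left] at h1
      nlinarith
  have := hanti (Set.left_mem_Icc.2 zero_le_one) (Set.right_mem_Icc.2 zero_le_one) zero_le_one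
  simp [hv] at this
  simp only [hv]
  linarith

theorem s2aux_cocoercive {d : ℕ} (f : EuclideanSpace ℝ (Fin d) → ℝ)
    (f' : EuclideanSpace ℝ (Fin d) → EuclideanSpace ℝ (Fin d)) (M : ℝ) (hM : 0 < M)
    (hlow : ∀ x y, f x + ⟪f' x, y - x⟫ ≤ f y)
    (hup : ∀ x y, f y ≤ f x + ⟪f' x, y - x⟫ + M / 2 * ‖y - x‖ ^ 2)
    (x y : EuclideanSpace ℝ (Fin d)) :
    ‖f' x - f' y‖ ^ 2 ≤ 2 * M * (f x - f y - ⟪f' y, x - y⟫) := by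
  set g := f' x - f' y with hg
  have h1 := hup x (x - (1 / M) • g)
  have h2 := hlow y (x - (1 / M) • g)
  have e1 : x - (1 / M) • g - x = -((1 / M) • g) := by abel
  have e2 : x - (1 / M) • g - y = (x - y) - (1 / M) • g := by abel
  rw [e1, norm_neg, norm_smul, inner_neg_right, inner_smul_right, mul_pow, Real.norm_eq_abs,
    sq_abs] at h1
  rw [e2, inner_sub_right, inner_smul_right] at h2
  have e3 : ⟪f' x, g⟫ - ⟪f' y, g⟫ = ‖g‖ ^ 2 := by
    rw [← inner_sub_left, ← hg, real_inner_self_eq_norm_sq]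
  have h3 : 1 / M * ‖g‖ ^ 2 - M / 2 * ((1 / M) ^ 2 * ‖g‖ ^ 2) ≤ f x - f y - ⟪f' y, x - y⟫ := by
    have h4 : 1 / M * ‖g‖ ^ 2 = 1 / M * ⟪f' x, g⟫ - 1 / M * ⟪f' y, g⟫ := by
      rw [← e3, mul_sub]
    linarith
  have e4 : 1 / M * ‖g‖ ^ 2 - M / 2 * ((1 / M) ^ 2 * ‖g‖ ^ 2) = ‖g‖ ^ 2 / (2 * M) := by
    field_simp
    ring
  rw [e4, div_le_iff₀ (by positivity)] at h3
  linarith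

/-! ### Averaging operator -/

/-- Averaging operator of a random map. -/
def s2avg {d n : ℕ} (s : Fin n → EuclideanSpace ℝ (Fin d) → EuclideanSpace ℝ (Fin d))
    (g : EuclideanSpace ℝ (Fin d) → ℝ) : EuclideanSpace ℝ (Fin d) → ℝ :=
  fun y => (1 / (n : ℝ)) * ∑ i, g (s i y)

theorem s2aux_fold_avg {d n : ℕ} (hn : 0 < n)
    (s : Fin n → EuclideanSpace ℝ (Fin d) → EuclideanSpace ℝ (Fin d))
    (g : EuclideanSpace ℝ (Fin d) → ℝ) (m : ℕ) :
    ∀ (T : ℕ) (_ : T ≤ m) (y : EuclideanSpace ℝ (Fin d)),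
      ∑ σ : Fin m → Fin n, ((1 : ℝ) / n) ^ m * g ((List.finRange m).foldl
        (fun y (t : Fin m) => if (t : ℕ) < T then s (σ t) y else y) y)
      = (s2avg s)^[T] g y := by
  have hn' : (n : ℝ) ≠ 0 := by positivity
  induction m with
  | zero =>
    intro T hT y
    obtain rfl : T = 0 := by omega
    simp
  | succ m ih =>
    intro T hT y
    rw [← (Fin.consEquiv (fun _ => Fin n)).sum_comp, Fintype.sum_prod_type]
    simp only [List.finRange_succ, List.foldl_cons, List.foldl_map, Fin.consEquiv_apply,
      Fin.cons_zero, Fin.cons_succ, Fin.val_zero, Fin.val_succ]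
    cases T with
    | zero =>
      have := ih 0 (Nat.zero_le _) y
      simp only [Nat.not_lt_zero, if_false, Function.iterate_zero, id_eq] at this ⊢
      have e : ∀ X : (Fin m → Fin n) → ℝ, ∑ σ, ((1 : ℝ) / n) ^ (m + 1) * X σ
          = 1 / n * ∑ σ, ((1 : ℝ) / n) ^ m * X σ := by
        intro X
        rw [Finset.mul_sum]
        exact Finset.sum_congr rfl fun σ _ => by ring
      rw [Finset.sum_congr rfl fun i _ => (e _).trans (congrArg _ this)]
      simp [hn']
    | succ T =>
      simp only [Nat.succ_pos, if_true, add_lt_add_iff_right]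
      rw [Function.iterate_succ_apply']
      simp only [s2avg]
      rw [Finset.mul_sum]
      refine Finset.sum_congr rfl fun i _ => ?_
      have := ih T (by omega) (s i y)
      change _ = _ * ((s2avg s)^[T] g (s i y))
      rw [← this, Finset.mul_sum]
      refine Finset.sum_congr rfl fun σ _ => ?_
      rw [pow_succ', mul_assoc]

theorem s2aux_avg_ineq {d n : ℕ} (hn : 0 < n)
    (s : Fin n → EuclideanSpace ℝ (Fin d) → EuclideanSpace ℝ (Fin d))
    (u v z : EuclideanSpace ℝ (Fin d) → ℝ) (a b c : ℝ)
    (huv : ∀ y, u y ≤ a * v y - b * z y + c) (t : ℕ) :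
    ∀ y, (s2avg s)^[t] u y ≤ a * (s2avg s)^[t] v y - b * (s2avg s)^[t] z y + c := by
  have hn' : (0 : ℝ) < n := by positivity
  induction t with
  | zero => simpa using huv
  | succ t ih =>
    intro y
    simp only [Function.iterate_succ_apply']
    have h1 := Finset.sum_le_sum (fun i (_ : i ∈ Finset.univ) => ih (s i y))
    simp only [Finset.sum_add_distrib, Finset.sum_sub_distrib, ← Finset.mul_sum,
      Finset.sum_const, Finset.card_univ, Fintype.card_fin, nsmul_eq_mul] at h1
    have h2 := mul_le_mul_of_nonneg_left h1 (by positivity : 0 ≤ 1 / (n : ℝ))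
    simp only [s2avg]
    change 1 / (n : ℝ) * ∑ i, (s2avg s)^[t] u (s i y) ≤
      a * (1 / (n : ℝ) * ∑ i, (s2avg s)^[t] v (s i y))
        - b * (1 / (n : ℝ) * ∑ i, (s2avg s)^[t] z (s i y)) + c
    refine h2.trans (le_of_eq ?_)
    field_simp

theorem s2aux_avg_nonneg {d n : ℕ}
    (s : Fin n → EuclideanSpace ℝ (Fin d) → EuclideanSpace ℝ (Fin d))
    (u : EuclideanSpace ℝ (Fin d) → ℝ) (hu : ∀ y, 0 ≤ u y) (t : ℕ) :
    ∀ y, 0 ≤ (s2avg s)^[t] u y := by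
  induction t with
  | zero => simpa using hu
  | succ t ih =>
    intro y
    simp only [Function.iterate_succ_apply']
    exact mul_nonneg (by positivity) (Finset.sum_nonneg fun i _ => ih _)

theorem s2aux_recursion (a D : ℕ → ℝ) (q κ C : ℝ) (hq : 0 ≤ q)
    (hrec : ∀ t, a (t + 1) ≤ q * a t - κ * D t + C) (m : ℕ) :
    a (m + 1) + κ * ∑ t ∈ Finset.range m, q ^ (m - (t + 1)) * D (t + 1)
      ≤ q ^ m * a 1 + C * ∑ t ∈ Finset.range m, q ^ (m - (t + 1)) := by
  induction m with
  | zero => simp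
  | succ m ih =>
    have key : ∀ G : ℕ → ℝ, ∑ t ∈ Finset.range (m + 1), q ^ (m + 1 - (t + 1)) * G t
        = q * ∑ t ∈ Finset.range m, q ^ (m - (t + 1)) * G t + G m := by
      intro G
      rw [Finset.sum_range_succ, Finset.mul_sum]
      congr 1
      · refine Finset.sum_congr rfl fun t ht => ?_
        have : t < m := Finset.mem_range.1 ht
        rw [show m + 1 - (t + 1) = (m - (t + 1)) + 1 by omega, pow_succ']
        ring
      · simp
    have k1 := key (fun t => D (t + 1))
    have k2 := key (fun _ => 1)
    simp only [mul_one] at k2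
    rw [k1, k2]
    have h1 := hrec (m + 1)
    have h2 := mul_le_mul_of_nonneg_left ih hq
    rw [pow_succ']
    nlinarith

/-! ### Epochs -/

theorem s2aux_epochs {X E : Type*} [Fintype X] (p : X → ℝ) (hp : ∀ x, 0 ≤ p x)
    (e : E → X → E) (D : E → ℝ) (c : ℝ) (hc : 0 ≤ c)
    (hstep : ∀ w, ∑ x, p x * D (e w x) ≤ c * D w) (k : ℕ) :
    ∀ w, ∑ ω : Fin k → X, (∏ j, p (ω j)) * D ((List.finRange k).foldl (fun w j => e w (ω j)) w)
      ≤ c ^ k * D w := by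
  induction k with
  | zero => intro w; simp
  | succ k ih =>
    intro w
    rw [← (Fin.consEquiv (fun _ => X)).sum_comp, Fintype.sum_prod_type]
    simp only [List.finRange_succ, List.foldl_cons, List.foldl_map, Fin.consEquiv_apply,
      Fin.cons_zero, Fin.cons_succ, Fin.prod_univ_succ]
    calc _ ≤ ∑ x, p x * (c ^ k * D (e w x)) := by
          refine Finset.sum_le_sum fun x _ => ?_
          simp only [mul_assoc, ← Finset.mul_sum]
          exact mul_le_mul_of_nonneg_left (ih (e w x)) (hp x)
      _ = c ^ k * ∑ x, p x * D (e w x) := by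
          rw [Finset.mul_sum]
          exact Finset.sum_congr rfl fun x _ => by ring
      _ ≤ c ^ k * (c * D w) := mul_le_mul_of_nonneg_left (hstep w) (pow_nonneg hc k)
      _ = _ := by ring

theorem s2aux_sum_one {X : Type*} [Fintype X] (p : X → ℝ) (hp : ∑ x, p x = 1) (k : ℕ) :
    ∑ ω : Fin k → X, ∏ j, p (ω j) = 1 := by
  induction k with
  | zero => simp
  | succ k ih =>
    rw [← (Fin.consEquiv (fun _ => X)).sum_comp, Fintype.sum_prod_type]
    simp only [Fin.consEquiv_apply, Fin.cons_zero, Fin.cons_succ, Fin.prod_univ_succ,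
      ← Finset.mul_sum, ih, mul_one, hp]

theorem s2aux_markov {X : Type*} [Fintype X] (p D : X → ℝ) (hp : ∀ x, 0 ≤ p x)
    (hD : ∀ x, 0 ≤ D x) (hp1 : ∑ x, p x = 1) (ε ρ D0 : ℝ) (hε : 0 < ε) (hρ : 0 < ρ)
    (hD0 : 0 ≤ D0) (hE : ∑ x, p x * D x ≤ ε * ρ * D0) (S : Set X)
    (hS : ∀ x, D x ≤ ε * D0 → x ∈ S) : 1 - ρ ≤ ∑ x, S.indicator p x := by
  classical
  rcases hD0.eq_or_lt with h0 | h0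
  · subst h0
    have hz : ∑ x, p x * D x = 0 :=
      le_antisymm (by simpa using hE) (Finset.sum_nonneg fun x _ => mul_nonneg (hp x) (hD x))
    rw [Finset.sum_eq_zero_iff_of_nonneg fun x _ => mul_nonneg (hp x) (hD x)] at hz
    have : ∑ x, S.indicator p x = ∑ x, p x := by
      refine Finset.sum_congr rfl fun x _ => ?_
      rcases mul_eq_zero.1 (hz x (Finset.mem_univ x)) with h | h
      · by_cases hx : x ∈ S <;> simp [hx, h]
      · rw [Set.indicator_of_mem (hS x (by simp [h]))]
    rw [this, hp1]
    linarith
  · have hpos : 0 < ε * D0 := mul_pos hε h0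
    have h1 : ∀ x, p x - p x * D x / (ε * D0) ≤ S.indicator p x := by
      intro x
      by_cases hx : x ∈ S
      · rw [Set.indicator_of_mem hx]
        have : 0 ≤ p x * D x / (ε * D0) := div_nonneg (mul_nonneg (hp x) (hD x)) hpos.le
        linarith
      · rw [Set.indicator_of_notMem hx]
        have h2 : ε * D0 < D x := by
          by_contra hcon
          exact hx (hS x (not_lt.1 hcon))
        have : p x ≤ p x * D x / (ε * D0) := by
          rw [le_div_iff₀ hpos]
          exact mul_le_mul_of_nonneg_left h2.le (hp x)
        linarith
    have h2 := Finset.sum_le_sum (fun x (_ : x ∈ Finset.univ) => h1 x)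
    rw [Finset.sum_sub_distrib, hp1, ← Finset.sum_div] at h2
    have h3 : (∑ x, p x * D x) / (ε * D0) ≤ ρ := by
      rw [div_le_iff₀ hpos]
      linarith
    linarith

/-! ### One inner step and one epoch -/

theorem s2aux_step {d n : ℕ} (hn : 0 < n)
    (F : Fin n → EuclideanSpace ℝ (Fin d) → ℝ)
    (F' : Fin n → EuclideanSpace ℝ (Fin d) → EuclideanSpace ℝ (Fin d))
    (Q : EuclideanSpace ℝ (Fin d) → ℝ)
    (Q' : EuclideanSpace ℝ (Fin d) → EuclideanSpace ℝ (Fin d))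
    (hQ : ∀ w, Q w = (1 / (n : ℝ)) * ∑ i, F i w)
    (hQ' : ∀ w, Q' w = (1 / (n : ℝ)) • ∑ i, F' i w)
    (M μ : ℝ) (hμ : 0 < μ)
    (hA : ∀ i x y, ‖F' i x - F' i y‖ ^ 2 ≤ 2 * M * (F i x - F i y - ⟪F' i y, x - y⟫))
    (hC : ∀ x y, Q x + ⟪Q' x, y - x⟫ + μ / 2 * ‖y - x‖ ^ 2 ≤ Q y)
    (ws : EuclideanSpace ℝ (Fin d)) (hws : Q' ws = 0) (h : ℝ) (hh : 0 < h) :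
    (∀ w y, (1 / (n : ℝ)) * ∑ i, ‖s2gdInnerStep F' h w (Q' w) i y - ws‖ ^ 2
      ≤ (1 - μ * h) * ‖y - ws‖ ^ 2 - 2 * h * (1 - 2 * M * h) * (Q y - Q ws)
        + 4 * (M - μ) * h ^ 2 * (Q w - Q ws)) ∧
    (M * h ≤ 1 → ∀ w, ‖w - h • Q' w - ws‖ ^ 2 ≤ ‖w - ws‖ ^ 2) := by
  have hn' : (0 : ℝ) < n := by positivity
  have hsumQ' : ∀ w, ∑ i, F' i w = (n : ℝ) • Q' w := by
    intro w
    rw [hQ', smul_smul, mul_one_div_cancel hn'.ne', one_smul]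
  have hsumQ : ∀ w, ∑ i, F i w = n * Q w := by
    intro w
    rw [hQ]
    field_simp
  -- average of squared gradient differences
  have hav : ∀ y, ∑ i, ‖F' i y - F' i ws‖ ^ 2 ≤ n * (2 * M * (Q y - Q ws)) := by
    intro y
    refine (Finset.sum_le_sum fun i _ => hA i y ws).trans (le_of_eq ?_)
    rw [← Finset.mul_sum, Finset.sum_sub_distrib, Finset.sum_sub_distrib, ← sum_inner,
      hsumQ', hws, hsumQ, hsumQ]
    simp
    ring
  have hsc : ∀ y, Q y - Q ws + μ / 2 * ‖y - ws‖ ^ 2 ≤ ⟪Q' y, y - ws⟫ := by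
    intro y
    have := hC y ws
    rw [← neg_sub y ws, inner_neg_right, norm_neg] at this
    linarith
  have hPL : ∀ w, 2 * μ * (Q w - Q ws) ≤ ‖Q' w‖ ^ 2 := by
    intro w
    have h1 := hsc w
    have h2 := real_inner_le_norm (Q' w) (w - ws)
    nlinarith [sq_nonneg (‖Q' w‖ - μ * ‖w - ws‖)]
  -- variance identity
  have hvar : ∀ w, ∑ i, ‖F' i w - F' i ws - Q' w‖ ^ 2
      = ∑ i, ‖F' i w - F' i ws‖ ^ 2 - n * ‖Q' w‖ ^ 2 := by
    intro w
    have : ∀ i, ‖F' i w - F' i ws - Q' w‖ ^ 2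
        = ‖F' i w - F' i ws‖ ^ 2 - 2 * ⟪F' i w - F' i ws, Q' w⟫ + ‖Q' w‖ ^ 2 :=
      fun i => norm_sub_sq_real _ _
    simp only [this]
    rw [Finset.sum_add_distrib, Finset.sum_sub_distrib, ← Finset.mul_sum, ← sum_inner,
      Finset.sum_sub_distrib, hsumQ', hsumQ', hws, smul_zero, sub_zero, inner_smul_left,
      real_inner_self_eq_norm_sq]
    simp
    ring
  refine ⟨fun w y => ?_, fun hMh w => ?_⟩
  · have e1 : ∀ i, ‖s2gdInnerStep F' h w (Q' w) i y - ws‖ ^ 2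
        = ‖y - ws‖ ^ 2 - 2 * h * ⟪y - ws, Q' w + F' i y - F' i w⟫
          + h ^ 2 * ‖Q' w + F' i y - F' i w‖ ^ 2 := by
      intro i
      rw [s2gdInnerStep, sub_right_comm, norm_sub_sq_real, inner_smul_right, norm_smul, mul_pow,
        Real.norm_eq_abs, sq_abs]
      ring
    have e2 : ∑ i, ⟪y - ws, Q' w + F' i y - F' i w⟫ = n * ⟪Q' y, y - ws⟫ := by
      rw [← inner_sum, Finset.sum_sub_distrib, Finset.sum_add_distrib, hsumQ', hsumQ']
      simp only [Finset.sum_const, Finset.card_univ, Fintype.card_fin]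
      rw [← Nat.cast_smul_eq_nsmul ℝ, add_sub_cancel_left, inner_smul_right, real_inner_comm]
    have e3 : ∑ i, ‖Q' w + F' i y - F' i w‖ ^ 2
        ≤ n * (4 * M * (Q y - Q ws) + 4 * (M - μ) * (Q w - Q ws)) := by
      have : ∀ i, ‖Q' w + F' i y - F' i w‖ ^ 2
          ≤ 2 * ‖F' i y - F' i ws‖ ^ 2 + 2 * ‖F' i w - F' i ws - Q' w‖ ^ 2 := by
        intro i
        have e : Q' w + F' i y - F' i w = (F' i y - F' i ws) - (F' i w - F' i ws - Q' w) := by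
          abel
        rw [e]
        have := parallelogram_law_with_norm ℝ (F' i y - F' i ws) (F' i w - F' i ws - Q' w)
        nlinarith [mul_self_nonneg ‖(F' i y - F' i ws) + (F' i w - F' i ws - Q' w)‖]
      refine (Finset.sum_le_sum fun i _ => this i).trans ?_
      rw [Finset.sum_add_distrib, ← Finset.mul_sum, ← Finset.mul_sum, hvar]
      have h1 := hav y
      have h2 := hav w
      have h3 := mul_le_mul_of_nonneg_left (hPL w) hn'.le
      linarith
    simp only [e1]
    rw [Finset.sum_add_distrib, Finset.sum_sub_distrib, ← Finset.mul_sum, ← Finset.mul_sum, e2]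
    simp only [Finset.sum_const, Finset.card_univ, Fintype.card_fin, nsmul_eq_mul]
    have h1 := mul_le_mul_of_nonneg_left e3 (sq_nonneg h)
    have h2 := mul_le_mul_of_nonneg_left (hsc y) (by positivity : 0 ≤ 2 * h)
    have h3 : (1 / (n : ℝ)) * (h ^ 2 * ∑ i, ‖Q' w + F' i y - F' i w‖ ^ 2)
        ≤ h ^ 2 * (4 * M * (Q y - Q ws) + 4 * (M - μ) * (Q w - Q ws)) := by
      refine (mul_le_mul_of_nonneg_left h1 (by positivity : 0 ≤ 1 / (n : ℝ))).trans
        (le_of_eq ?_)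
      field_simp
    have h4 : (1 / (n : ℝ)) * (n * ‖y - ws‖ ^ 2 - 2 * h * (n * ⟪Q' y, y - ws⟫)
        + h ^ 2 * ∑ i, ‖Q' w + F' i y - F' i w‖ ^ 2)
        = ‖y - ws‖ ^ 2 - 2 * h * ⟪Q' y, y - ws⟫
          + (1 / (n : ℝ)) * (h ^ 2 * ∑ i, ‖Q' w + F' i y - F' i w‖ ^ 2) := by
      field_simp
    rw [h4]
    linarith
  · have h1 := hsc w
    have h2 : ‖Q' w‖ ^ 2 ≤ 2 * M * (Q w - Q ws) := by
      have h3 := hav w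
      have h4 := hvar w
      have h5 : 0 ≤ ∑ i, ‖F' i w - F' i ws - Q' w‖ ^ 2 :=
        Finset.sum_nonneg fun i _ => sq_nonneg _
      rw [h4] at h5
      exact le_of_mul_le_mul_left (by linarith) hn'
    have hD : 0 ≤ Q w - Q ws := by
      have := hC ws w
      rw [hws, inner_zero_left] at this
      have : 0 ≤ μ / 2 * ‖w - ws‖ ^ 2 := by positivity
      linarith
    rw [sub_right_comm, norm_sub_sq_real, inner_smul_right, norm_smul, mul_pow,
        Real.norm_eq_abs, sq_abs, real_inner_comm]
    have h3 := mul_le_mul_of_nonneg_left h2 (sq_nonneg h)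
    have h4 : h * (Q w - Q ws) ≤ h * ⟪Q' w, w - ws⟫ := by
      apply mul_le_mul_of_nonneg_left _ hh.le
      have : 0 ≤ μ / 2 * ‖w - ws‖ ^ 2 := by positivity
      linarith
    have h5 : 0 ≤ (1 - M * h) * (h * (Q w - Q ws)) :=
      mul_nonneg (by linarith) (mul_nonneg hh.le hD)
    linarith

theorem s2aux_epoch {d n : ℕ} (hn : 0 < n)
    (F : Fin n → EuclideanSpace ℝ (Fin d) → ℝ)
    (F' : Fin n → EuclideanSpace ℝ (Fin d) → EuclideanSpace ℝ (Fin d))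
    (Q : EuclideanSpace ℝ (Fin d) → ℝ)
    (Q' : EuclideanSpace ℝ (Fin d) → EuclideanSpace ℝ (Fin d))
    (hQ : ∀ w, Q w = (1 / (n : ℝ)) * ∑ i, F i w)
    (hQ' : ∀ w, Q' w = (1 / (n : ℝ)) • ∑ i, F' i w)
    (M μ : ℝ) (hM : 0 < M) (hμ : 0 < μ)
    (hA : ∀ i x y, ‖F' i x - F' i y‖ ^ 2 ≤ 2 * M * (F i x - F i y - ⟪F' i y, x - y⟫))
    (hC : ∀ x y, Q x + ⟪Q' x, y - x⟫ + μ / 2 * ‖y - x‖ ^ 2 ≤ Q y)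
    (ws : EuclideanSpace ℝ (Fin d)) (hws : Q' ws = 0) (h ν : ℝ) (hh : 0 < h)
    (hνμ : ν ≤ μ) (hνh : ν * h < 1) (hhM : 0 < 1 - 2 * M * h) (m : ℕ)
    (β : ℝ) (hβ : β = ∑ t ∈ Finset.range m, (1 - ν * h) ^ (m - (t + 1))) (hβ0 : 0 < β)
    (w : EuclideanSpace ℝ (Fin d)) :
    ∑ x : Fin m × (Fin m → Fin n), ((1 - ν * h) ^ (m - ((x.1 : ℕ) + 1)) / β)
        * ((1 : ℝ) / (n : ℝ)) ^ m * (Q (s2gdEpoch F' Q' h m w ((x.1 : ℕ) + 1) x.2) - Q ws)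
      ≤ ((1 - ν * h) ^ m / (β * μ * h * (1 - 2 * M * h)) + 2 * (M - μ) * h / (1 - 2 * M * h))
        * (Q w - Q ws) := by
  have hn' : (0 : ℝ) < n := by positivity
  obtain ⟨hs1, hs2⟩ := s2aux_step hn F F' Q Q' hQ hQ' M μ hμ hA hC ws hws h hh
  set s := s2gdInnerStep F' h w (Q' w) with hs
  set V : EuclideanSpace ℝ (Fin d) → ℝ := fun y => ‖y - ws‖ ^ 2 with hV
  set D : EuclideanSpace ℝ (Fin d) → ℝ := fun y => Q y - Q ws with hDdef
  set q := 1 - ν * h with hq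
  have hq0 : 0 < q := by rw [hq]; linarith
  have hD : μ / 2 * V w ≤ D w := by
    have := hC ws w
    rw [hws, inner_zero_left] at this
    simp only [hV, hDdef]
    linarith
  have hpt : ∀ y, s2avg s V y ≤ q * V y - 2 * h * (1 - 2 * M * h) * D y
      + 4 * (M - μ) * h ^ 2 * D w := by
    intro y
    refine (hs1 w y).trans ?_
    have : (1 - μ * h) * ‖y - ws‖ ^ 2 ≤ q * V y := by
      apply mul_le_mul_of_nonneg_right _ (sq_nonneg _)
      rw [hq]
      have := mul_le_mul_of_nonneg_right hνμ hh.le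
      linarith
    simp only [hDdef]
    linarith
  have hrec := s2aux_recursion (fun t => (s2avg s)^[t] V w) (fun t => (s2avg s)^[t] D w) q
    (2 * h * (1 - 2 * M * h)) (4 * (M - μ) * h ^ 2 * D w) hq0.le
    (fun t => by
      have := s2aux_avg_ineq hn s _ _ _ _ _ _ hpt t w
      rwa [← Function.iterate_succ_apply] at this) m
  have ha : 0 ≤ (s2avg s)^[m + 1] V w := s2aux_avg_nonneg s V (fun y => sq_nonneg _) _ _
  have ha1 : (s2avg s)^[1] V w ≤ V w := by
    simp only [Function.iterate_one, s2avg, hs, s2gdInnerStep, hV, add_sub_cancel_right]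
    simp only [Finset.sum_const, Finset.card_univ, Fintype.card_fin, nsmul_eq_mul]
    rw [← mul_assoc, one_div_mul_cancel hn'.ne', one_mul]
    exact hs2 (by nlinarith) w
  rw [← hβ] at hrec
  have hsum : ∑ x : Fin m × (Fin m → Fin n), (q ^ (m - ((x.1 : ℕ) + 1)) / β)
        * ((1 : ℝ) / (n : ℝ)) ^ m * (Q (s2gdEpoch F' Q' h m w ((x.1 : ℕ) + 1) x.2) - Q ws)
      = (∑ t ∈ Finset.range m, q ^ (m - (t + 1)) * (s2avg s)^[t + 1] D w) / β := by
    rw [Fintype.sum_prod_type, Finset.sum_div,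
      Finset.sum_range (fun t => q ^ (m - (t + 1)) * (s2avg s)^[t + 1] D w / β)]
    refine Finset.sum_congr rfl fun t _ => ?_
    have := s2aux_fold_avg hn s D m ((t : ℕ) + 1) (by omega) w
    rw [← this, Finset.mul_sum, Finset.sum_div]
    refine Finset.sum_congr rfl fun σ _ => ?_
    simp only [hDdef, s2gdEpoch, hs]
    ring
  rw [hsum, div_le_iff₀ hβ0]
  set S := ∑ t ∈ Finset.range m, q ^ (m - (t + 1)) * (s2avg s)^[t + 1] D w with hSdef
  have hqm : 0 ≤ q ^ m := pow_nonneg hq0.le m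
  have hV2 : V w ≤ 2 / μ * D w := by
    rw [div_mul_eq_mul_div, le_div_iff₀ hμ]
    linarith
  have h1 : q ^ m * (s2avg s)^[1] V w ≤ q ^ m * (2 / μ * D w) :=
    mul_le_mul_of_nonneg_left (ha1.trans hV2) hqm
  have hκ : 0 < 2 * h * (1 - 2 * M * h) := by positivity
  have h2 : 2 * h * (1 - 2 * M * h) * S
      ≤ q ^ m * (2 / μ * D w) + 4 * (M - μ) * h ^ 2 * D w * β := by linarith
  refine le_of_mul_le_mul_left (h2.trans (le_of_eq ?_)) hκ
  change _ = 2 * h * (1 - 2 * M * h) * ((_ * D w) * β)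
  have := hhM.ne'
  generalize 1 - 2 * M * h = r at *
  field_simp
  ring

/-- **High-probability complexity of S2GD for (non-strongly) convex loss**
(Theorem 2.8 of Konečný's thesis).  Let `P` be the average of convex `L`-smooth functions
`f i`, attaining its minimum at `wstar`.  Fix `w0` and `μ > 0`, and let S2GD be applied to
the perturbed problem with `f̂ i w = f i w + (μ/2)‖w − w0‖²` (so gradients
`f̂' i w = f' i w + μ(w − w0)`).  If `0 ≤ ν ≤ μ`, `0 < h < 1/(2(L+μ))` and
`ĉ = (1−νh)^m / (βμh(1−2(L+μ)h)) + 2Lh/(1−2(L+μ)h) < 1`, then for any `0 < ρ < 1`,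
`0 < ε < 1` and integer `k ≥ log(1/(ερ))/log(1/ĉ)`, with probability at least `1 − ρ`,
`P(ŵ^k) − P(w*) ≤ ε (P(w^0) − P(w*)) + (μ/2)‖w^0 − w*‖²`. -/
theorem s2gd_convex_loss_high_probability
    (d n : ℕ) (hn : 0 < n)
    (f : Fin n → EuclideanSpace ℝ (Fin d) → ℝ)
    (f' : Fin n → EuclideanSpace ℝ (Fin d) → EuclideanSpace ℝ (Fin d))
    (hgrad : ∀ i x, HasGradientAt (f i) (f' i x) x)
    (hconvex : ∀ i, ConvexOn ℝ Set.univ (f i))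
    (L : ℝ) (hL : 0 < L)
    (hLip : ∀ i (x y : EuclideanSpace ℝ (Fin d)), ‖f' i x - f' i y‖ ≤ L * ‖x - y‖)
    (P : EuclideanSpace ℝ (Fin d) → ℝ)
    (hP : ∀ w, P w = (1 / (n : ℝ)) * ∑ i, f i w)
    (wstar : EuclideanSpace ℝ (Fin d)) (hmin : ∀ w, P wstar ≤ P w)
    (w0 : EuclideanSpace ℝ (Fin d)) (μ : ℝ) (hμ : 0 < μ)
    (fhat' : Fin n → EuclideanSpace ℝ (Fin d) → EuclideanSpace ℝ (Fin d))
    (hfhat' : ∀ i w, fhat' i w = f' i w + μ • (w - w0))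
    (Phat' : EuclideanSpace ℝ (Fin d) → EuclideanSpace ℝ (Fin d))
    (hPhat' : ∀ w, Phat' w = (1 / (n : ℝ)) • ∑ i, fhat' i w)
    (m : ℕ) (hm : 1 ≤ m) (h ν : ℝ)
    (hν0 : 0 ≤ ν) (hνμ : ν ≤ μ) (hνh : ν * h < 1)
    (hh0 : 0 < h) (hhL : h < 1 / (2 * (L + μ)))
    (β : ℝ) (hβ : β = ∑ t ∈ Finset.range m, (1 - ν * h) ^ (m - (t + 1)))
    (chat : ℝ)
    (hchat : chat = (1 - ν * h) ^ m / (β * μ * h * (1 - 2 * (L + μ) * h))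
        + 2 * L * h / (1 - 2 * (L + μ) * h))
    (hchat1 : chat < 1)
    (ρ ε : ℝ) (hρ0 : 0 < ρ) (hρ1 : ρ < 1) (hε0 : 0 < ε) (hε1 : ε < 1)
    (k : ℕ) (hk : Real.log (1 / (ε * ρ)) / Real.log (1 / chat) ≤ (k : ℝ)) :
    1 - ρ ≤
      ∑ ω : Fin k → Fin m × (Fin m → Fin n),
        Set.indicator
          {ω' | P (s2gdIterate fhat' Phat' h m w0 k ω') - P wstar
              ≤ ε * (P w0 - P wstar) + μ / 2 * ‖w0 - wstar‖ ^ 2}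
          (fun ω' => s2gdWeight n ν h β m ω') ω := by
  classical
  have hn' : (0 : ℝ) < n := by positivity
  have hM : 0 < L + μ := by linarith
  -- perturbed functions
  set F : Fin n → EuclideanSpace ℝ (Fin d) → ℝ := fun i w => f i w + μ / 2 * ‖w - w0‖ ^ 2
    with hF
  set Q : EuclideanSpace ℝ (Fin d) → ℝ := fun w => P w + μ / 2 * ‖w - w0‖ ^ 2 with hQdef
  have hnorm : ∀ x y : EuclideanSpace ℝ (Fin d),
      ‖y - w0‖ ^ 2 = ‖x - w0‖ ^ 2 + 2 * ⟪x - w0, y - x⟫ + ‖y - x‖ ^ 2 := by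
    intro x y
    rw [← norm_add_sq_real]
    congr 2
    abel
  have hlow : ∀ i x y, F i x + ⟪fhat' i x, y - x⟫ + μ / 2 * ‖y - x‖ ^ 2 ≤ F i y := by
    intro i x y
    have h1 := s2aux_first_order (f i) (f' i) (hgrad i) (hconvex i) x y
    simp only [hF]
    rw [hnorm x y, hfhat', inner_add_left, real_inner_smul_left]
    linarith
  have hup : ∀ i x y, F i y ≤ F i x + ⟪fhat' i x, y - x⟫ + (L + μ) / 2 * ‖y - x‖ ^ 2 := by
    intro i x y
    have h1 := s2aux_descent (f i) (f' i) (hgrad i) L (hLip i) x y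
    simp only [hF]
    rw [hnorm x y, hfhat', inner_add_left, real_inner_smul_left]
    linarith
  have hQ : ∀ w, Q w = (1 / (n : ℝ)) * ∑ i, F i w := by
    intro w
    simp only [hQdef, hF]
    rw [hP, Finset.sum_add_distrib]
    simp only [Finset.sum_const, Finset.card_univ, Fintype.card_fin, nsmul_eq_mul]
    field_simp
  have hinner : ∀ x v, ⟪Phat' x, v⟫ = (1 / (n : ℝ)) * ∑ i, ⟪fhat' i x, v⟫ := by
    intro x v
    rw [hPhat', real_inner_smul_left, sum_inner]
  have hC : ∀ x y, Q x + ⟪Phat' x, y - x⟫ + μ / 2 * ‖y - x‖ ^ 2 ≤ Q y := by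
    intro x y
    have h1 := Finset.sum_le_sum (fun i (_ : i ∈ Finset.univ) => hlow i x y)
    have h2 := mul_le_mul_of_nonneg_left h1 (by positivity : 0 ≤ 1 / (n : ℝ))
    rw [hQ, hQ, hinner]
    refine le_trans (le_of_eq ?_) h2
    simp only [Finset.sum_add_distrib, Finset.sum_const, Finset.card_univ, Fintype.card_fin,
      nsmul_eq_mul]
    field_simp
  have hCup : ∀ x y, Q y ≤ Q x + ⟪Phat' x, y - x⟫ + (L + μ) / 2 * ‖y - x‖ ^ 2 := by
    intro x y
    have h1 := Finset.sum_le_sum (fun i (_ : i ∈ Finset.univ) => hup i x y)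
    have h2 := mul_le_mul_of_nonneg_left h1 (by positivity : 0 ≤ 1 / (n : ℝ))
    rw [hQ, hQ, hinner]
    refine le_trans h2 (le_of_eq ?_)
    simp only [Finset.sum_add_distrib, Finset.sum_const, Finset.card_univ, Fintype.card_fin,
      nsmul_eq_mul]
    field_simp
  have hA : ∀ i x y, ‖fhat' i x - fhat' i y‖ ^ 2
      ≤ 2 * (L + μ) * (F i x - F i y - ⟪fhat' i y, x - y⟫) := by
    intro i x y
    refine s2aux_cocoercive (F i) (fhat' i) (L + μ) hM (fun x y => ?_) (hup i) x y
    have := hlow i x y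
    have : 0 ≤ μ / 2 * ‖y - x‖ ^ 2 := by positivity
    linarith
  -- minimizer of the perturbed problem
  obtain ⟨ws, hwsmin⟩ : ∃ ws, ∀ w, Q ws ≤ Q w := by
    have hcont : Continuous Q := by
      have : Continuous P := by
        have e : P = fun w => (1 / (n : ℝ)) * ∑ i, f i w := funext hP
        rw [e]
        refine continuous_const.mul (continuous_finsetSum _ fun i _ => ?_)
        exact continuous_iff_continuousAt.2 fun x => (hgrad i x).hasFDerivAt.continuousAt
      exact this.add (by fun_prop)
    refine hcont.exists_forall_le ?_
    have ht : Filter.Tendsto (fun w : EuclideanSpace ℝ (Fin d) => ‖w - w0‖)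
        (Filter.cocompact _) Filter.atTop := by
      refine Filter.tendsto_atTop_mono (fun w => norm_sub_norm_le w w0) ?_
      exact Filter.tendsto_atTop_add_const_right _ _ (tendsto_norm_cocompact_atTop)
    have ht2 : Filter.Tendsto (fun w : EuclideanSpace ℝ (Fin d) =>
        P wstar + μ / 2 * ‖w - w0‖ ^ 2) (Filter.cocompact _) Filter.atTop := by
      refine Filter.tendsto_atTop_add_const_left _ _ ?_
      refine Filter.Tendsto.const_mul_atTop (by positivity) ?_
      exact (Filter.tendsto_pow_atTop two_ne_zero).comp ht
    refine Filter.tendsto_atTop_mono (fun w => ?_) ht2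
    have := hmin w
    simp only [hQdef]
    linarith
  have hws : Phat' ws = 0 := by
    have h1 := hCup ws (ws - (1 / (L + μ)) • Phat' ws)
    have h2 := hwsmin (ws - (1 / (L + μ)) • Phat' ws)
    have e1 : ws - (1 / (L + μ)) • Phat' ws - ws = -((1 / (L + μ)) • Phat' ws) := by abel
    rw [e1, norm_neg, norm_smul, inner_neg_right, inner_smul_right, mul_pow, Real.norm_eq_abs,
      sq_abs, real_inner_self_eq_norm_sq] at h1
    have h3 : 1 / (L + μ) * ‖Phat' ws‖ ^ 2
        - (L + μ) / 2 * ((1 / (L + μ)) ^ 2 * ‖Phat' ws‖ ^ 2) ≤ 0 := by linarith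
    have e4 : 1 / (L + μ) * ‖Phat' ws‖ ^ 2
        - (L + μ) / 2 * ((1 / (L + μ)) ^ 2 * ‖Phat' ws‖ ^ 2)
        = ‖Phat' ws‖ ^ 2 / (2 * (L + μ)) := by
      field_simp
      ring
    rw [e4, div_le_iff₀ (by positivity), zero_mul] at h3
    have : ‖Phat' ws‖ = 0 := by
      have := sq_nonneg ‖Phat' ws‖
      exact pow_eq_zero_iff two_ne_zero |>.1 (le_antisymm h3 this)
    exact norm_eq_zero.1 this
  -- constants
  have hr : 0 < 1 - 2 * (L + μ) * h := by
    rw [lt_div_iff₀ (by positivity)] at hhL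
    linarith
  have hq0 : 0 < 1 - ν * h := by linarith
  have hβ0 : 0 < β := by
    rw [hβ]
    exact Finset.sum_pos (fun t _ => pow_pos hq0 _) ⟨0, Finset.mem_range.2 hm⟩
  have hc0 : 0 < chat := by
    rw [hchat]
    positivity
  have hck : chat ^ k ≤ ε * ρ := by
    have hlog : 0 < Real.log (1 / chat) := Real.log_pos (by rw [lt_div_iff₀ hc0]; linarith)
    rw [div_le_iff₀ hlog, one_div, one_div, Real.log_inv, Real.log_inv] at hk
    have hερ : 0 < ε * ρ := mul_pos hε0 hρ0
    rw [← Real.log_le_log_iff (pow_pos hc0 k) hερ, Real.log_pow]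
    linarith
  -- weights
  set p : Fin m × (Fin m → Fin n) → ℝ := fun x =>
    ((1 - ν * h) ^ (m - ((x.1 : ℕ) + 1)) / β) * ((1 : ℝ) / (n : ℝ)) ^ m with hp
  have hp0 : ∀ x, 0 ≤ p x := fun x => by
    simp only [hp]
    have := pow_pos hq0 (m - ((x.1 : ℕ) + 1))
    positivity
  have hp1 : ∑ x, p x = 1 := by
    simp only [hp]
    rw [Fintype.sum_prod_type]
    simp only [Finset.sum_const, Finset.card_univ, Fintype.card_pi, Fintype.card_fin,
      Finset.prod_const, nsmul_eq_mul, Nat.cast_pow]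
    have e : ∀ t : Fin m, (n : ℝ) ^ m * ((1 - ν * h) ^ (m - ((t : ℕ) + 1)) / β * (1 / (n : ℝ)) ^ m)
        = (1 - ν * h) ^ (m - ((t : ℕ) + 1)) / β := by
      intro t
      rw [one_div, inv_pow]
      field_simp
    simp only [e]
    rw [← Finset.sum_div, ← Finset.sum_range (fun t => (1 - ν * h) ^ (m - (t + 1))), ← hβ,
      div_self hβ0.ne']
  have hstep : ∀ w, ∑ x, p x * (Q (s2gdEpoch fhat' Phat' h m w ((x.1 : ℕ) + 1) x.2) - Q ws)
      ≤ chat * (Q w - Q ws) := by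
    intro w
    have := s2aux_epoch hn F fhat' Q Phat' hQ hPhat' (L + μ) μ hM hμ hA hC ws hws h ν hh0
      hνμ hνh hr m β hβ hβ0 w
    rw [add_sub_cancel_right, ← hchat] at this
    exact this
  have hEk := s2aux_epochs p hp0 (fun w x => s2gdEpoch fhat' Phat' h m w ((x.1 : ℕ) + 1) x.2)
    (fun w => Q w - Q ws) chat hc0.le hstep k w0
  have hD0 : 0 ≤ Q w0 - Q ws := sub_nonneg.2 (hwsmin w0)
  refine s2aux_markov (fun ω => s2gdWeight n ν h β m ω)
    (fun ω => Q (s2gdIterate fhat' Phat' h m w0 k ω) - Q ws)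
    (fun ω => Finset.prod_nonneg fun j _ => hp0 (ω j)) (fun ω => sub_nonneg.2 (hwsmin _))
    (s2aux_sum_one p hp1 k) ε ρ (Q w0 - Q ws) hε0 hρ0 hD0
    (le_trans hEk (mul_le_mul_of_nonneg_right hck hD0)) _ (fun ω hω => ?_)
  simp only [Set.mem_ofPred_eq]
  have h1 := mul_le_mul_of_nonneg_left (hwsmin wstar) (by linarith : 0 ≤ 1 - ε)
  simp only [hQdef, sub_self, norm_zero] at hω h1
  rw [norm_sub_rev wstar w0] at h1
  have h2 : 0 ≤ μ / 2 * ‖s2gdIterate fhat' Phat' h m w0 k ω - w0‖ ^ 2 := by positivity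
  have h3 : 0 ≤ ε * (μ / 2 * ‖w0 - wstar‖ ^ 2) := by positivity
  nlinarith
end
end

section
/- Let f : ℝ^d → ℝ be convex and differentiable, let j ∈ {1, …, d}, and suppose there is a constant L_j > 0 such that f(x + t e_j) ≤ f(x) + t ∇_j f(x) + (L_j/2) t² for all x ∈ ℝ^d and t ∈ ℝ. Then for all x, y ∈ ℝ^d: ( ∇_j f(x) − ∇_j f(y) )² ≤ 2 L_j ( f(x) − f(y) − ⟨∇f(y), x − y⟩ ). -/
open scoped RealInnerProductSpace BigOperators

/-- **Coordinate co-coercivity** (Lemma 3.3 of Konečný's thesis).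
Let `f : ℝ^d → ℝ` be convex and differentiable with gradient `f'`, let `j` be a coordinate,
and suppose there is `Lj > 0` with `f(x + t e_j) ≤ f(x) + t ∇_j f(x) + (Lj/2) t²` for all
`x` and `t`.  Then for all `x, y`:
`(∇_j f(x) − ∇_j f(y))² ≤ 2 Lj (f(x) − f(y) − ⟨∇f(y), x − y⟩)`. -/
theorem coordinate_cocoercivity
    (d : ℕ) (f : EuclideanSpace ℝ (Fin d) → ℝ)
    (f' : EuclideanSpace ℝ (Fin d) → EuclideanSpace ℝ (Fin d))
    (hgrad : ∀ x, HasGradientAt f (f' x) x)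
    (hconvex : ConvexOn ℝ Set.univ f)
    (j : Fin d) (Lj : ℝ) (hLj : 0 < Lj)
    (hsmooth : ∀ (x : EuclideanSpace ℝ (Fin d)) (t : ℝ),
      f (x + t • EuclideanSpace.single j (1 : ℝ))
        ≤ f x + t * (f' x) j + Lj / 2 * t ^ 2)
    (x y : EuclideanSpace ℝ (Fin d)) :
    ((f' x) j - (f' y) j) ^ 2 ≤ 2 * Lj * (f x - f y - ⟪f' y, x - y⟫) := by
  have first : ∀ z, f y + ⟪f' y, z - y⟫ ≤ f z := by
    intro z
    have hc : ConvexOn ℝ Set.univ (fun t : ℝ => f (AffineMap.lineMap y z t)) :=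
      hconvex.comp_affineMap (AffineMap.lineMap y z : ℝ →ᵃ[ℝ] EuclideanSpace ℝ (Fin d))
    have hd : HasDerivAt (fun t : ℝ => f (AffineMap.lineMap y z t)) ⟪f' y, z - y⟫ 0 := by
      have h1 : HasDerivAt (fun t : ℝ => AffineMap.lineMap y z t) (z - y) (0 : ℝ) :=
        AffineMap.hasDerivAt_lineMap
      have h2 : HasFDerivAt f (InnerProductSpace.toDual ℝ _ (f' y))
          (AffineMap.lineMap y z (0 : ℝ)) := by
        rw [AffineMap.lineMap_apply_zero]
        exact (hgrad y).hasFDerivAt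
      have h3 := h2.comp_hasDerivAt (0 : ℝ) h1
      rw [InnerProductSpace.toDual_apply_apply] at h3
      exact h3
    have h := hc.le_slope_of_hasDerivAt (Set.mem_univ 0) (Set.mem_univ 1) one_pos hd
    simp [slope_def_field] at h
    linarith
  have h1 := first (x + (-((f' x) j - (f' y) j) / Lj) • EuclideanSpace.single j (1 : ℝ))
  have h2 := hsmooth x (-((f' x) j - (f' y) j) / Lj)
  rw [add_sub_right_comm, inner_add_right, inner_smul_right,
    EuclideanSpace.inner_single_right] at h1
  simp only [conj_trivial, one_mul] at h1
  have h3 := h1.trans h2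
  set a := (f' x) j
  set b := (f' y) j
  have h4 : (a - b) ^ 2 / (2 * Lj) ≤ f x - f y - ⟪f' y, x - y⟫ := by
    have e : (a - b) ^ 2 / (2 * Lj)
        = -(-(a - b) / Lj * a + Lj / 2 * (-(a - b) / Lj) ^ 2) + -(a - b) / Lj * b := by
      field_simp
      ring
    linarith
  rw [div_le_iff₀ (by positivity)] at h4
  linarith
end
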